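/- arXiv:1809.03624 — 6 statements merged into one kernel-verified Lean document; each statement's English description precedes it below -/
import Mathlib

section
/- Let F be a field and consider the polynomial ring F[t] with its standard ℤ-grading (t in degree 1). Every finitely generated ℤ-graded F[t]-module M is isomorphic, as a graded module, to a finite direct sum of the form (⊕_{q=1}^{Q} t^{n_q}·F[t]) ⊕ (⊕_{ℓ=1}^{L} (t^{m_ℓ}·F[t])/(t^{m_ℓ+d_ℓ})) for some integers n_q, m_ℓ ∈ ℤ and positive integers d_ℓ ∈ ℕ. Here t^{a}·F[t] denotes the free graded F[t]-module of rank one with generator in degree a, and graded isomorphism means an F[t]-module isomorphism preserving the grading. -/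
open scoped Classical

/-- A `ℤ`-graded module over the polynomial ring `F[t]` (with `t` in degree `1`),
recorded by its data: the degree-`j` components (which are `F`-vector spaces) together
with the `F`-linear multiplication-by-`t` maps `M_j → M_{j+1}`. -/
structure GrMod (F : Type) [Field F] where
  part : ℤ → Type
  [instAdd : ∀ j, AddCommGroup (part j)]
  [instMod : ∀ j, Module F (part j)]
  tmul : ∀ j : ℤ, part j →ₗ[F] part (j + 1)

attribute [instance] GrMod.instAdd GrMod.instMod

variable {F : Type} [Field F]

/-- `M` is finitely generated (as an `F[t]`-module): there are finitely many
(homogeneous) elements contained in no proper graded submodule of `M`, where a graded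
submodule is a degreewise family of subspaces closed under multiplication by `t`. -/
def GrMod.FG (M : GrMod F) : Prop :=
  ∃ s : Finset (Σ j : ℤ, M.part j),
    ∀ S : ∀ j : ℤ, Submodule F (M.part j),
      (∀ j, (S j).map (M.tmul j) ≤ S (j + 1)) →
      (∀ x ∈ s, Sigma.snd x ∈ S x.1) →
      ∀ j, S j = ⊤

/-- Graded isomorphism: degreewise `F`-linear equivalences commuting with
multiplication by `t`. -/
def GrMod.Iso (M N : GrMod F) : Prop :=
  ∃ e : ∀ j : ℤ, M.part j ≃ₗ[F] N.part j,
    ∀ j : ℤ, (e (j + 1)).toLinearMap ∘ₗ M.tmul j = N.tmul j ∘ₗ (e j).toLinearMap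

/-- The graded module `(⊕_{q} t^{n q}·F[t]) ⊕ (⊕_{l} (t^{m l}·F[t])/(t^{m l + d l}))`:
its degree-`j` component has one copy of `F` for each `q` with `n q ≤ j` and one copy
of `F` for each `l` with `m l ≤ j < m l + d l`, and multiplication by `t` acts as the
identity between consecutive copies of `F` whenever possible, and by `0` otherwise. -/
noncomputable def barcodeGrMod (F : Type) [Field F] {Q L : ℕ}
    (n : Fin Q → ℤ) (m : Fin L → ℤ) (d : Fin L → ℕ) : GrMod F where
  part j := ((q : Fin Q) → PLift (n q ≤ j) → F) ×
    ((l : Fin L) → PLift (m l ≤ j ∧ j < m l + d l) → F)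
  tmul j :=
    { toFun := fun x =>
        (fun q _ => if h : n q ≤ j then x.1 q ⟨h⟩ else 0,
         fun l _ => if h : m l ≤ j ∧ j < m l + d l then x.2 l ⟨h⟩ else 0)
      map_add' := by
        intro x y
        refine Prod.ext ?_ ?_ <;> funext _ _ <;> dsimp <;> split <;> simp
      map_smul' := by
        intro c x
        refine Prod.ext ?_ ?_ <;> funext _ _ <;> dsimp <;> split <;> simp }

/-- iterated multiplication by `t`, as a map between arbitrary components -/
noncomputable def GrMod.Tn (M : GrMod F) : ℕ → ∀ i j : ℤ, M.part i →ₗ[F] M.part j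
  | 0, i, j => if h : i = j then h ▸ LinearMap.id else 0
  | k + 1, i, j => GrMod.Tn M k (i + 1) j ∘ₗ M.tmul i

lemma GrMod.Tn_succ (M : GrMod F) (k : ℕ) : ∀ (i j : ℤ), i + k = j →
    M.Tn (k + 1) i (j + 1) = M.tmul j ∘ₗ M.Tn k i j := by
  induction k with
  | zero =>
    intro i j h
    have h : i = j := by simpa using h
    subst h
    ext x
    simp [GrMod.Tn]
  | succ k ih =>
    intro i j h
    have := ih (i + 1) j (by push_cast at h; omega)
    conv_lhs => rw [GrMod.Tn]
    conv_rhs => rw [GrMod.Tn]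
    rw [this, LinearMap.comp_assoc]

noncomputable def GrMod.T (M : GrMod F) (i j : ℤ) : M.part i →ₗ[F] M.part j :=
  if i ≤ j then M.Tn (j - i).toNat i j else 0

lemma GrMod.T_self (M : GrMod F) (i : ℤ) (x : M.part i) : M.T i i x = x := by
  simp [GrMod.T, GrMod.Tn]

lemma GrMod.T_of_lt (M : GrMod F) {i j : ℤ} (h : j < i) (x : M.part i) : M.T i j x = 0 := by
  simp [GrMod.T, not_le.mpr h]

lemma GrMod.T_succ (M : GrMod F) {i j : ℤ} (h : i ≤ j) (x : M.part i) :
    M.T i (j + 1) x = M.tmul j (M.T i j x) := by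
  have h2 : (j + 1 - i).toNat = (j - i).toNat + 1 := by omega
  have h3 : i ≤ j + 1 := by omega
  simp only [GrMod.T, h, h3, if_true, h2]
  rw [M.Tn_succ _ _ _ (by omega)]
  rfl

lemma GrMod.T_comp (M : GrMod F) {i j k : ℤ} (h : i ≤ j) (h' : j ≤ k) (x : M.part i) :
    M.T j k (M.T i j x) = M.T i k x := by
  induction k, h' using Int.le_induction with
  | base => rw [M.T_self]
  | succ k hk ih => rw [M.T_succ hk, ih, M.T_succ (h.trans hk)]

lemma GrMod.T_mem (M : GrMod F) (S : ∀ j : ℤ, Submodule F (M.part j))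
    (hS : ∀ j, (S j).map (M.tmul j) ≤ S (j + 1)) {i : ℤ} (x : M.part i) (hx : x ∈ S i)
    (j : ℤ) : M.T i j x ∈ S j := by
  rcases lt_or_ge j i with h | h
  · rw [M.T_of_lt h]; exact zero_mem _
  · induction j, h using Int.le_induction with
    | base => rwa [M.T_self]
    | succ k hk ih => rw [M.T_succ hk]; exact hS k (Submodule.mem_map_of_mem ih)

/-- order of a homogeneous element -/
noncomputable def GrMod.ord (M : GrMod F) {i : ℤ} (x : M.part i) : ℕ∞ :=
  sInf {k : ℕ∞ | ∃ n : ℕ, k = n ∧ M.T i (i + n) x = 0}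

lemma GrMod.ord_le_iff (M : GrMod F) {i : ℤ} (x : M.part i) (n : ℕ) :
    M.ord x ≤ n ↔ M.T i (i + n) x = 0 := by
  constructor
  · intro h
    have hne : {k : ℕ∞ | ∃ n : ℕ, k = n ∧ M.T i (i + n) x = 0}.Nonempty := by
      by_contra hc
      rw [Set.not_nonempty_iff_eq_empty] at hc
      rw [GrMod.ord, hc, sInf_empty] at h
      exact absurd h (by simp)
    obtain ⟨m, hm, hz⟩ := csInf_mem hne
    change M.ord x = m at hm
    rw [hm] at h
    have h : m ≤ n := by exact_mod_cast h
    rw [← M.T_comp (j := i + m) (by omega) (by omega), hz, map_zero]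
  · intro h
    exact sInf_le ⟨n, rfl, h⟩

def GrMod.Gen (M : GrMod F) {ι : Type} (a : ι → ℤ) (x : ∀ i, M.part (a i)) : Prop :=
  ∀ S : ∀ j : ℤ, Submodule F (M.part j),
      (∀ j, (S j).map (M.tmul j) ≤ S (j + 1)) → (∀ i, x i ∈ S (a i)) → ∀ j, S j = ⊤

lemma GrMod.Gen.span (M : GrMod F) {ι : Type} [Fintype ι] (a : ι → ℤ)
    (x : ∀ i, M.part (a i)) (h : M.Gen a x) (j : ℤ) (y : M.part j) :
    ∃ c : ι → F, ∑ i, c i • M.T (a i) j (x i) = y := by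
  have := h (fun j => Submodule.span F (Set.range fun i => M.T (a i) j (x i))) ?_ ?_ j
  · have hy : y ∈ Submodule.span F (Set.range fun i => M.T (a i) j (x i)) := by
      rw [this]; trivial
    exact (Submodule.mem_span_range_iff_exists_fun F).1 hy
  · intro j
    rw [Submodule.map_span_le]
    rintro _ ⟨i, rfl⟩
    rcases lt_or_ge j (a i) with h | h
    · simp only [M.T_of_lt h, map_zero]; exact zero_mem _
    · rw [← M.T_succ h]
      exact Submodule.subset_span ⟨i, rfl⟩
  · intro i
    exact Submodule.subset_span ⟨i, M.T_self _ _⟩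

lemma GrMod.exists_indep (M : GrMod F) {ι : Type} [Fintype ι] (a : ι → ℤ)
    (x₀ : ∀ i, M.part (a i)) (h₀ : M.Gen a x₀) :
    ∃ x : ∀ i, M.part (a i), M.Gen a x ∧ ∀ (j : ℤ) (c : ι → F),
      ∑ i, c i • M.T (a i) j (x i) = 0 → ∀ i, c i • M.T (a i) j (x i) = 0 := by
  let R : (∀ i, M.part (a i)) → (ι → ℕ∞) := fun x i => M.ord (x i)
  obtain ⟨x, hx, hmin⟩ := (InvImage.wf R (wellFounded_lt)).has_min
    {x | M.Gen a x} ⟨x₀, h₀⟩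
  refine ⟨x, hx, ?_⟩
  intro j c hc
  by_contra hcon
  push Not at hcon
  obtain ⟨i₀, hi₀⟩ := hcon
  -- the terms which are nonzero
  let s : Finset ι := Finset.univ.filter fun i => c i • M.T (a i) j (x i) ≠ 0
  have hs : s.Nonempty := ⟨i₀, by simpa [s] using hi₀⟩
  obtain ⟨i, his, himax⟩ := s.exists_max_image a hs
  have hsum : ∑ k ∈ s, c k • M.T (a k) j (x k) = 0 := by
    rw [← hc]
    exact Finset.sum_filter_ne_zero _
  have hi : c i • M.T (a i) j (x i) ≠ 0 := by simpa [s] using his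
  have hci : c i ≠ 0 := fun h => hi (by simp [h])
  have hTi : M.T (a i) j (x i) ≠ 0 := fun h => hi (by simp [h])
  have hij : a i ≤ j := by
    by_contra h
    exact hTi (M.T_of_lt (by omega) _)
  let y : M.part (a i) := ∑ k ∈ s, c k • M.T (a k) (a i) (x k)
  have hy : M.T (a i) j y = 0 := by
    rw [← hsum, map_sum]
    refine Finset.sum_congr rfl fun k hk => ?_
    rw [map_smul, M.T_comp (himax k hk) hij]
  have hgen : M.Gen a (Function.update x i y) := by
    intro S hS hxS
    refine hx S hS ?_
    have hne : ∀ k, k ≠ i → x k ∈ S (a k) := by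
      intro k hk
      have := hxS k
      rwa [Function.update_of_ne hk] at this
    have hyS : y ∈ S (a i) := by
      have := hxS i
      rwa [Function.update_self] at this
    have hysplit : y = c i • x i + ∑ k ∈ s.erase i, c k • M.T (a k) (a i) (x k) := by
      simp only [y]
      rw [← Finset.add_sum_erase _ _ his, M.T_self]
    have hsumS : ∑ k ∈ s.erase i, c k • M.T (a k) (a i) (x k) ∈ S (a i) := by
      refine Submodule.sum_mem _ fun k hk => Submodule.smul_mem _ _ ?_
      exact M.T_mem S hS _ (hne k (Finset.ne_of_mem_erase hk)) _
    intro k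
    by_cases hk : k = i
    · subst hk
      rw [hysplit] at hyS
      have := (Submodule.add_mem_iff_left _ hsumS).1 hyS
      exact (Submodule.smul_mem_iff _ hci).1 this
    · exact hne k hk
  apply hmin _ hgen
  have hlt : M.ord y < M.ord (x i) := by
    have e : a i + ((j - a i).toNat : ℤ) = j := by omega
    have h1 : M.ord y ≤ ((j - a i).toNat : ℕ) := by
      rw [M.ord_le_iff, e]; exact hy
    have h2 : ¬ M.ord (x i) ≤ ((j - a i).toNat : ℕ) := by
      rw [M.ord_le_iff, e]; exact hTi
    exact lt_of_le_of_lt h1 (not_le.1 h2)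
  change R _ < R x
  rw [Pi.lt_def]
  refine ⟨fun k => ?_, i, ?_⟩
  · by_cases hk : k = i
    · subst hk
      simp only [R, Function.update_self]
      exact hlt.le
    · simp only [R, Function.update_of_ne hk]
      exact le_rfl
  · simp only [R, Function.update_self]
    exact hlt

/-- coefficient functional on the barcode module -/
noncomputable def barCoef {ι : Type} {Q L : ℕ} (n : Fin Q → ℤ) (m : Fin L → ℤ) (d : Fin L → ℕ)
    (p : ι → Option (Fin Q ⊕ Fin L)) (j : ℤ) (i : ι) :
    (barcodeGrMod F n m d).part j →ₗ[F] F where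
  toFun z := match p i with
    | none => 0
    | some (.inl q) => if h : n q ≤ j then z.1 q ⟨h⟩ else 0
    | some (.inr l) => if h : m l ≤ j ∧ j < m l + d l then z.2 l ⟨h⟩ else 0
  map_add' z w := by
    rcases p i with _ | q | l
    · simp
    · dsimp only
      split
      · rfl
      · simp
    · dsimp only
      split
      · rfl
      · simp
  map_smul' r z := by
    rcases p i with _ | q | l
    · simp
    · dsimp only
      split
      · rfl
      · simp
    · dsimp only
      split
      · rfl
      · simp

section
variable {ι : Type} {Q L : ℕ} (n : Fin Q → ℤ) (m : Fin L → ℤ) (d : Fin L → ℕ)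
    (p : ι → Option (Fin Q ⊕ Fin L)) (j : ℤ) (i : ι) (z : (barcodeGrMod F n m d).part j)

lemma barCoef_none (hp : p i = none) : barCoef n m d p j i z = 0 := by
  change (match p i with
    | none => 0
    | some (.inl q) => if h : n q ≤ j then z.1 q ⟨h⟩ else 0
    | some (.inr l) => if h : m l ≤ j ∧ j < m l + d l then z.2 l ⟨h⟩ else 0 : F) = _
  rw [hp]

lemma barCoef_inl (q : Fin Q) (hp : p i = some (.inl q)) :
    barCoef n m d p j i z = if h : n q ≤ j then z.1 q ⟨h⟩ else 0 := by
  change (match p i with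
    | none => 0
    | some (.inl q) => if h : n q ≤ j then z.1 q ⟨h⟩ else 0
    | some (.inr l) => if h : m l ≤ j ∧ j < m l + d l then z.2 l ⟨h⟩ else 0 : F) = _
  rw [hp]

lemma barCoef_inr (l : Fin L) (hp : p i = some (.inr l)) :
    barCoef n m d p j i z = if h : m l ≤ j ∧ j < m l + d l then z.2 l ⟨h⟩ else 0 := by
  change (match p i with
    | none => 0
    | some (.inl q) => if h : n q ≤ j then z.1 q ⟨h⟩ else 0
    | some (.inr l) => if h : m l ≤ j ∧ j < m l + d l then z.2 l ⟨h⟩ else 0 : F) = _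
  rw [hp]

lemma barcode_tmul_fst (q : Fin Q) (h' : PLift (n q ≤ j + 1)) :
    ((barcodeGrMod F n m d).tmul j z).1 q h' = if h : n q ≤ j then z.1 q ⟨h⟩ else 0 := rfl

lemma barcode_tmul_snd (l : Fin L) (h' : PLift (m l ≤ j + 1 ∧ j + 1 < m l + d l)) :
    ((barcodeGrMod F n m d).tmul j z).2 l h' =
      if h : m l ≤ j ∧ j < m l + d l then z.2 l ⟨h⟩ else 0 := rfl
end

lemma barcode_aux (M : GrMod F) {ι : Type} [Fintype ι] (a : ι → ℤ)
    (x : ∀ i, M.part (a i)) (hgen : M.Gen a x)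
    (hind : ∀ (j : ℤ) (c : ι → F),
      ∑ i, c i • M.T (a i) j (x i) = 0 → ∀ i, c i • M.T (a i) j (x i) = 0)
    {Q L : ℕ} (n : Fin Q → ℤ) (m : Fin L → ℤ) (d : Fin L → ℕ)
    (p : ι → Option (Fin Q ⊕ Fin L)) (u : Fin Q → ι) (v : Fin L → ι)
    (hu : ∀ q, p (u q) = some (.inl q)) (hv : ∀ l, p (v l) = some (.inr l))
    (hu' : ∀ i q, p i = some (.inl q) → u q = i) (hv' : ∀ i l, p i = some (.inr l) → v l = i)
    (h0 : ∀ i, p i = none → ∀ j, M.T (a i) j (x i) = 0)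
    (h1 : ∀ i q, p i = some (.inl q) → ∀ j, M.T (a i) j (x i) ≠ 0 ↔ n q ≤ j)
    (h2 : ∀ i l, p i = some (.inr l) → ∀ j, M.T (a i) j (x i) ≠ 0 ↔ (m l ≤ j ∧ j < m l + d l))
    (h1a : ∀ i q, p i = some (.inl q) → n q = a i)
    (h2a : ∀ i l, p i = some (.inr l) → m l = a i) :
    M.Iso (barcodeGrMod F n m d) := by
  let N := barcodeGrMod F n m d
  let f : ∀ j, N.part j →ₗ[F] M.part j := fun j =>
    ∑ i, (barCoef n m d p j i).smulRight (M.T (a i) j (x i))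
  have hf : ∀ j z, f j z = ∑ i, barCoef n m d p j i z • M.T (a i) j (x i) := by
    intro j z
    simp [f]
  have hinj : ∀ j, Function.Injective (f j) := by
    intro j
    rw [← LinearMap.ker_eq_bot, LinearMap.ker_eq_bot']
    intro z hz
    rw [hf] at hz
    have hz := hind j _ hz
    refine Prod.ext ?_ ?_
    · funext q ⟨h⟩
      have h3 := hz (u q)
      rcases smul_eq_zero.1 h3 with h3 | h3
      · rw [barCoef_inl n m d p j _ z q (hu q), dif_pos h] at h3
        exact h3
      · exact absurd h3 ((h1 _ q (hu q) j).2 h)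
    · funext l ⟨h⟩
      have h3 := hz (v l)
      rcases smul_eq_zero.1 h3 with h3 | h3
      · rw [barCoef_inr n m d p j _ z l (hv l), dif_pos h] at h3
        exact h3
      · exact absurd h3 ((h2 _ l (hv l) j).2 h)
  have hsurj : ∀ j, Function.Surjective (f j) := by
    intro j y
    obtain ⟨c, hc⟩ := GrMod.Gen.span M a x hgen j y
    let z : N.part j := (fun q _ => c (u q), fun l _ => c (v l))
    refine ⟨z, ?_⟩
    rw [hf, ← hc]
    refine Finset.sum_congr rfl fun i _ => ?_
    by_cases hT : M.T (a i) j (x i) = 0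
    · simp [hT]
    · congr 1
      rcases hp : p i with _ | q | l
      · exact absurd (h0 i hp j) hT
      · have := (h1 i q hp j).1 hT
        rw [barCoef_inl n m d p j _ z q hp, dif_pos this]
        exact congrArg c (hu' i q hp)
      · have := (h2 i l hp j).1 hT
        rw [barCoef_inr n m d p j _ z l hp, dif_pos this]
        exact congrArg c (hv' i l hp)
  have hcomm : ∀ j z, f (j + 1) (N.tmul j z) = M.tmul j (f j z) := by
    intro j z
    rw [hf, hf, map_sum]
    refine Finset.sum_congr rfl fun i _ => ?_
    rw [map_smul]
    rcases lt_or_ge j (a i) with hlt | hge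
    · rw [M.T_of_lt hlt, map_zero, smul_zero]
      rcases hp : p i with _ | q | l
      · rw [barCoef_none _ _ _ _ _ _ _ hp, zero_smul]
      · have : ¬ n q ≤ j := by rw [h1a i q hp]; omega
        rw [barCoef_inl _ _ _ _ _ _ _ q hp]
        simp only [N, barcode_tmul_fst]
        rw [dif_neg this]
        simp
      · have : ¬ m l ≤ j := by rw [h2a i l hp]; omega
        rw [barCoef_inr _ _ _ _ _ _ _ l hp]
        simp only [N, barcode_tmul_snd]
        have h5 : ¬ (m l ≤ j ∧ j < m l + d l) := fun h => this h.1
        simp only [dif_neg h5]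
        simp
    · rw [← M.T_succ hge]
      by_cases hT : M.T (a i) (j + 1) (x i) = 0
      · simp [hT]
      · congr 1
        rcases hp : p i with _ | q | l
        · rw [barCoef_none _ _ _ _ _ _ _ hp, barCoef_none _ _ _ _ _ _ _ hp]
        · have h3 : n q ≤ j := by rw [h1a i q hp]; omega
          have h4 : n q ≤ j + 1 := by omega
          rw [barCoef_inl _ _ _ _ _ _ _ q hp, barCoef_inl _ _ _ _ _ _ _ q hp, dif_pos h4]
          exact barcode_tmul_fst n m d j z q ⟨h4⟩
        · have h4 := (h2 i l hp (j + 1)).1 hT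
          have h3 : m l ≤ j ∧ j < m l + d l := by
            refine ⟨?_, by omega⟩
            rw [h2a i l hp]; omega
          rw [barCoef_inr _ _ _ _ _ _ _ l hp, barCoef_inr _ _ _ _ _ _ _ l hp, dif_pos h4]
          exact barcode_tmul_snd n m d j z l ⟨h4⟩
  refine ⟨fun j => (LinearEquiv.ofBijective (f j) ⟨hinj j, hsurj j⟩).symm, fun j => ?_⟩
  ext1 y
  obtain ⟨z, rfl⟩ := hsurj j y
  simp only [LinearMap.comp_apply, LinearEquiv.coe_coe]
  rw [LinearEquiv.symm_apply_eq]
  have : (LinearEquiv.ofBijective (f j) ⟨hinj j, hsurj j⟩).symm (f j z) = z := by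
    rw [LinearEquiv.symm_apply_eq]; rfl
  rw [this]
  exact (hcomm j z).symm

/-- **Structure theorem for finitely generated graded `F[t]`-modules** (barcode
decomposition): every finitely generated `ℤ`-graded module over `F[t]` is isomorphic,
as a graded module, to a finite direct sum
`(⊕_{q=1}^{Q} t^{n q}·F[t]) ⊕ (⊕_{l=1}^{L} (t^{m l}·F[t])/(t^{m l + d l}))`
with all `d l` positive. -/
theorem graded_module_barcode_decomposition (M : GrMod F) (hM : M.FG) :
    ∃ (Q L : ℕ) (n : Fin Q → ℤ) (m : Fin L → ℤ) (d : Fin L → ℕ),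
      (∀ l, 0 < d l) ∧ M.Iso (barcodeGrMod F n m d) := by
  obtain ⟨s, hs⟩ := hM
  have hgen₀ : M.Gen (ι := s) (fun i => i.1.1) (fun i => i.1.2) := by
    intro S hS hx
    exact hs S hS fun x hxs => hx ⟨x, hxs⟩
  obtain ⟨x, hgen, hind⟩ := M.exists_indep _ _ hgen₀
  let a : s → ℤ := fun i => i.1.1
  let o : s → ℕ∞ := fun i => M.ord (x i)
  let eQ := Fintype.equivFin {i : s // o i = ⊤}
  let eL := Fintype.equivFin {i : s // o i ≠ ⊤ ∧ o i ≠ 0}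
  have key : ∀ i j, M.T (a i) j (x i) ≠ 0 ↔ a i ≤ j ∧ ((j - a i).toNat : ℕ∞) < o i := by
    intro i j
    rcases lt_or_ge j (a i) with h | h
    · simp only [M.T_of_lt h]
      simp [h]
    · have e : a i + ((j - a i).toNat : ℤ) = j := by omega
      have := M.ord_le_iff (x i) (j - a i).toNat
      change _ ↔ M.T (a i) (a i + _) (x i) = 0 at this
      rw [e] at this
      rw [ne_eq, ← this, not_le]
      simp [h, o]
  let p : s → Option (_ ⊕ _) := fun i =>
    if h : o i = ⊤ then some (.inl (eQ ⟨i, h⟩))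
    else if h' : o i = 0 then none else some (.inr (eL ⟨i, h, h'⟩))
  have pl : ∀ i q, p i = some (.inl q) → (eQ.symm q).1 = i := by
    intro i q h
    simp only [p] at h
    split_ifs at h
    all_goals simp at h
    all_goals simp [← h]
  have pr : ∀ i l, p i = some (.inr l) → (eL.symm l).1 = i := by
    intro i l h
    simp only [p] at h
    split_ifs at h
    all_goals simp at h
    all_goals simp [← h]
  refine ⟨_, _, fun q => a (eQ.symm q).1, fun l => a (eL.symm l).1,
    fun l => (o (eL.symm l).1).toNat, ?_, ?_⟩
  · intro l
    obtain ⟨h1, h2⟩ := (eL.symm l).2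
    rw [Nat.pos_iff_ne_zero, ne_eq, ENat.toNat_eq_zero]
    tauto
  · refine barcode_aux M a x hgen hind _ _ _ p (fun q => (eQ.symm q).1) (fun l => (eL.symm l).1)
      ?_ ?_ pl pr ?_ ?_ ?_ ?_ ?_
    · intro q
      have := (eQ.symm q).2
      simp [p, this]
    · intro l
      have := (eL.symm l).2
      simp [p, this.1, this.2]
    · intro i hi j
      by_contra hT
      have := (key i j).1 hT
      simp only [p] at hi
      split_ifs at hi with h1 h2
      simp [h2] at this
    · intro i q hq j
      have h := pl i q hq
      have ht := (eQ.symm q).2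
      rw [key]
      simp only [h] at ht ⊢
      simp [ht]
    · intro i l hl j
      have h := pr i l hl
      have ht := (eL.symm l).2
      rw [key]
      simp only [h] at ht ⊢
      obtain ⟨k, hk⟩ := ENat.ne_top_iff_exists.1 ht.1
      rw [← hk]
      simp only [ENat.toNat_coe, Nat.cast_lt]
      omega
    · intro i q hq
      simp only [pl i q hq]
    · intro i l hl
      simp only [pr i l hl]
end

section
/- Let F be a field. Suppose a finitely generated ℤ-graded F[t]-module M admits two graded direct sum decompositions M ≅ (⊕_{q=1}^{Q} t^{n_q}·F[t]) ⊕ (⊕_{ℓ=1}^{L} (t^{m_ℓ}·F[t])/(t^{m_ℓ+d_ℓ})) and M ≅ (⊕_{q=1}^{Q'} t^{n'_q}·F[t]) ⊕ (⊕_{ℓ=1}^{L'} (t^{m'_ℓ}·F[t])/(t^{m'_ℓ+d'_ℓ})) with all d_ℓ, d'_ℓ positive. Then Q = Q', L = L', the multiset {n_1,…,n_Q} equals the multiset {n'_1,…,n'_{Q'}}, and the multiset of pairs {(m_1,d_1),…,(m_L,d_L)} equals the multiset {(m'_1,d'_1),…,(m'_{L'},d'_{L'})}. Consequently the multiset of intervals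 [n_q,∞) and [m_ℓ, m_ℓ+d_ℓ) (the barcode) is a complete invariant of the graded isomorphism type of M. -/
open scoped Classical

variable {F : Type} [Field F]

/-- Iterated successor, so that `t ^ k` has a convenient type. -/
def barShift (j : ℤ) : ℕ → ℤ
  | 0 => j
  | k + 1 => barShift j k + 1

theorem barShift_eq (j : ℤ) (k : ℕ) : barShift j k = j + k := by
  induction k with
  | zero => simp [barShift]
  | succ k ih => simp [barShift, ih, add_assoc]

/-- Multiplication by `t ^ k`. -/
def barPow (M : GrMod F) (j : ℤ) : (k : ℕ) → M.part j →ₗ[F] M.part (barShift j k)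
  | 0 => LinearMap.id
  | k + 1 => M.tmul (barShift j k) ∘ₗ barPow M j k

/-- Dimension of the kernel of `t ^ k` in degree `j`. -/
noncomputable def barKer (M : GrMod F) (j : ℤ) (k : ℕ) : ℕ :=
  Module.finrank F (LinearMap.ker (barPow M j k))

theorem barPow_comm {M N : GrMod F} (e : ∀ j : ℤ, M.part j ≃ₗ[F] N.part j)
    (he : ∀ j : ℤ, (e (j + 1)).toLinearMap ∘ₗ M.tmul j = N.tmul j ∘ₗ (e j).toLinearMap)
    (j : ℤ) (k : ℕ) (x : M.part j) :
    e (barShift j k) (barPow M j k x) = barPow N j k (e j x) := by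
  induction k with
  | zero => rfl
  | succ k ih =>
    have h := LinearMap.congr_fun (he (barShift j k)) (barPow M j k x)
    simp only [LinearMap.comp_apply, LinearEquiv.coe_coe] at h
    rw [ih] at h
    exact h

theorem barKer_iso {M N : GrMod F} (h : M.Iso N) (j : ℤ) (k : ℕ) :
    barKer M j k = barKer N j k := by
  obtain ⟨e, he⟩ := h
  have hmap : (LinearMap.ker (barPow M j k)).map (e j).toLinearMap
      = LinearMap.ker (barPow N j k) := by
    ext y
    simp only [Submodule.mem_map, LinearMap.mem_ker, LinearEquiv.coe_coe]
    constructor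
    · rintro ⟨x, hx, rfl⟩
      rw [← barPow_comm e he, hx, map_zero]
    · intro hy
      refine ⟨(e j).symm y, ?_, by simp⟩
      apply (e (barShift j k)).injective
      rw [barPow_comm e he]
      simpa using hy
  unfold barKer
  rw [← hmap]
  exact (LinearEquiv.finrank_map_eq (e j) _).symm

theorem finrank_bar {L : ℕ} (p : Fin L → Prop) [DecidablePred p] :
    Module.finrank F ((l : Fin L) → PLift (p l) → F) = ∑ l, if p l then 1 else 0 := by
  rw [Module.finrank_pi_fintype]
  refine Finset.sum_congr rfl fun l _ => ?_
  rw [Module.finrank_pi]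
  split_ifs with h
  · exact Fintype.card_eq_one_iff.2 ⟨⟨h⟩, fun _ => rfl⟩
  · exact Fintype.card_eq_zero_iff.2 ⟨fun x => h x.down⟩

theorem barDim {Q L : ℕ} (n : Fin Q → ℤ) (m : Fin L → ℤ) (d : Fin L → ℕ) (j : ℤ) :
    Module.finrank F ((barcodeGrMod F n m d).part j) =
      (∑ q, if n q ≤ j then 1 else 0) +
      ∑ l, if m l ≤ j ∧ j < m l + d l then 1 else 0 := by
  rw [← finrank_bar (F := F), ← finrank_bar (F := F)]
  exact Module.finrank_prod

theorem barPow_fst {Q L : ℕ} (n : Fin Q → ℤ) (m : Fin L → ℤ) (d : Fin L → ℕ) (j : ℤ)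
    (k : ℕ) (x : (barcodeGrMod F n m d).part j) (q : Fin Q) (h : n q ≤ j)
    (h' : PLift (n q ≤ barShift j k)) :
    (barPow (barcodeGrMod F n m d) j k x).1 q h' = x.1 q ⟨h⟩ := by
  induction k with
  | zero => rfl
  | succ k ih =>
    have h2 : n q ≤ barShift j k := by rw [barShift_eq]; omega
    rw [← ih ⟨h2⟩]
    exact dif_pos h2

theorem barPow_fst_zero {Q L : ℕ} (n : Fin Q → ℤ) (m : Fin L → ℤ) (d : Fin L → ℕ) (j : ℤ)
    (k : ℕ) (x : (barcodeGrMod F n m d).part j) (q : Fin Q) (h : ¬ n q ≤ j)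
    (h' : PLift (n q ≤ barShift j k)) :
    (barPow (barcodeGrMod F n m d) j k x).1 q h' = 0 := by
  induction k with
  | zero => exact absurd h'.down h
  | succ k ih =>
    by_cases h2 : n q ≤ barShift j k
    · rw [← ih ⟨h2⟩]
      exact dif_pos h2
    · exact dif_neg h2

theorem barPow_snd {Q L : ℕ} (n : Fin Q → ℤ) (m : Fin L → ℤ) (d : Fin L → ℕ) (j : ℤ)
    (k : ℕ) (x : (barcodeGrMod F n m d).part j) (l : Fin L) (h : m l ≤ j ∧ j < m l + d l)
    (h' : PLift (m l ≤ barShift j k ∧ barShift j k < m l + d l)) :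
    (barPow (barcodeGrMod F n m d) j k x).2 l h' = x.2 l ⟨h⟩ := by
  induction k with
  | zero => rfl
  | succ k ih =>
    have h2 : m l ≤ barShift j k ∧ barShift j k < m l + d l := by
      have := h'.down
      simp only [barShift_eq] at this ⊢
      push_cast at this
      omega
    rw [← ih ⟨h2⟩]
    exact dif_pos h2

theorem barPow_snd_zero {Q L : ℕ} (n : Fin Q → ℤ) (m : Fin L → ℤ) (d : Fin L → ℕ) (j : ℤ)
    (k : ℕ) (x : (barcodeGrMod F n m d).part j) (l : Fin L)
    (h : ¬ (m l ≤ j ∧ j < m l + d l))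
    (h' : PLift (m l ≤ barShift j k ∧ barShift j k < m l + d l)) :
    (barPow (barcodeGrMod F n m d) j k x).2 l h' = 0 := by
  induction k with
  | zero => exact absurd h'.down h
  | succ k ih =>
    by_cases h2 : m l ≤ barShift j k ∧ barShift j k < m l + d l
    · rw [← ih ⟨h2⟩]
      exact dif_pos h2
    · exact dif_neg h2

theorem bar_mem_ker {Q L : ℕ} (n : Fin Q → ℤ) (m : Fin L → ℤ) (d : Fin L → ℕ) (j : ℤ)
    (k : ℕ) (x : (barcodeGrMod F n m d).part j) :
    x ∈ LinearMap.ker (barPow (barcodeGrMod F n m d) j k) ↔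
      (∀ q h, x.1 q h = 0) ∧ ∀ l h, j + k < m l + d l → x.2 l h = 0 := by
  rw [LinearMap.mem_ker]
  constructor
  · intro hx
    constructor
    · intro q h
      have h2 : n q ≤ barShift j k := by have := h.down; rw [barShift_eq]; omega
      rw [← barPow_fst n m d j k x q h.down ⟨h2⟩, hx]
      rfl
    · intro l h hl
      have h2 : m l ≤ barShift j k ∧ barShift j k < m l + d l := by
        have := h.down; rw [barShift_eq]; omega
      rw [← barPow_snd n m d j k x l h.down ⟨h2⟩, hx]
      rfl
  · rintro ⟨h1, h2⟩
    refine Prod.ext ?_ ?_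
    · funext q h
      by_cases hq : n q ≤ j
      · exact (barPow_fst n m d j k x q hq h).trans (h1 _ _)
      · exact barPow_fst_zero n m d j k x q hq h
    · funext l h
      by_cases hl : m l ≤ j ∧ j < m l + d l
      · refine (barPow_snd n m d j k x l hl h).trans (h2 _ _ ?_)
        have := h.down.2
        rwa [barShift_eq] at this
      · exact barPow_snd_zero n m d j k x l hl h

/-- Coordinates on the kernel of `t ^ k`. -/
noncomputable def barKerEquiv {Q L : ℕ} (n : Fin Q → ℤ) (m : Fin L → ℤ) (d : Fin L → ℕ)
    (j : ℤ) (k : ℕ) :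
    LinearMap.ker (barPow (barcodeGrMod F n m d) j k) ≃ₗ[F]
      ((l : Fin L) → PLift (m l ≤ j ∧ j < m l + d l ∧ m l + d l ≤ j + k) → F) where
  toFun x := fun l h => x.1.2 l ⟨h.down.1, h.down.2.1⟩
  map_add' x y := rfl
  map_smul' c x := rfl
  invFun y := ⟨(0, fun l h => if h' : m l + d l ≤ j + k then
      y l ⟨h.down.1, h.down.2, h'⟩ else 0), by
    refine (bar_mem_ker n m d j k _).2 ⟨fun q h => rfl, fun l h hl => dif_neg (by omega)⟩⟩
  left_inv x := by
    have hx := (bar_mem_ker n m d j k x.1).1 x.2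
    apply Subtype.ext
    refine Prod.ext ?_ ?_
    · funext q h
      exact (hx.1 q h).symm
    · funext l h
      by_cases h' : m l + d l ≤ j + k
      · exact dif_pos h'
      · exact (dif_neg h').trans (hx.2 l h (by omega)).symm
  right_inv y := by
    funext l h
    exact dif_pos h.down.2.2

theorem barKer_eq {Q L : ℕ} (n : Fin Q → ℤ) (m : Fin L → ℤ) (d : Fin L → ℕ)
    (j : ℤ) (k : ℕ) :
    barKer (barcodeGrMod F n m d) j k =
      ∑ l, if m l ≤ j ∧ j < m l + d l ∧ m l + d l ≤ j + k then 1 else 0 := by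
  rw [← finrank_bar (F := F)]
  exact (barKerEquiv n m d j k).finrank_eq

theorem bar_count_map {α : Type} [DecidableEq α] {L : ℕ} (f : Fin L → α) (a : α) :
    Multiset.count a (Multiset.map f Finset.univ.val) = ∑ l, if f l = a then 1 else 0 := by
  rw [Multiset.count_map, ← Finset.filter_val, Finset.card_val, Finset.card_filter]
  simp only [eq_comm]

theorem bar_count_pair {Q L : ℕ} (n : Fin Q → ℤ) (m : Fin L → ℤ) (d : Fin L → ℕ)
    (a : ℤ) (b : ℕ) :
    Multiset.count (a, b + 1) (Multiset.map (fun l => (m l, d l)) Finset.univ.val) +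
      barKer (barcodeGrMod F n m d) a b + barKer (barcodeGrMod F n m d) (a - 1) (b + 2) =
    barKer (barcodeGrMod F n m d) a (b + 1) +
      barKer (barcodeGrMod F n m d) (a - 1) (b + 1) := by
  rw [bar_count_map]
  simp only [barKer_eq, ← Finset.sum_add_distrib, Prod.mk.injEq]
  refine Finset.sum_congr rfl fun l _ => ?_
  push_cast
  split_ifs <;> omega

theorem bar_count_free {Q : ℕ} (n : Fin Q → ℤ) (a : ℤ) :
    Multiset.count a (Multiset.map n Finset.univ.val) +
      (∑ q, if n q ≤ a - 1 then 1 else 0) = ∑ q, if n q ≤ a then 1 else 0 := by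
  rw [bar_count_map]
  simp only [← Finset.sum_add_distrib]
  refine Finset.sum_congr rfl fun l _ => ?_
  split_ifs <;> omega

theorem bar_count_zero {L : ℕ} (m : Fin L → ℤ) (d : Fin L → ℕ) (hd : ∀ l, 0 < d l) (a : ℤ) :
    Multiset.count (a, 0) (Multiset.map (fun l => (m l, d l)) Finset.univ.val) = 0 := by
  rw [bar_count_map]
  refine Finset.sum_eq_zero fun l _ => if_neg ?_
  intro h
  have := hd l
  simp only [Prod.mk.injEq] at h
  omega

theorem bar_sum_map {L : ℕ} (m : Fin L → ℤ) (d : Fin L → ℕ) (j : ℤ) :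
    (∑ l, if m l ≤ j ∧ j < m l + d l then 1 else 0) =
    (Multiset.map (fun p : ℤ × ℕ => if p.1 ≤ j ∧ j < p.1 + p.2 then 1 else 0)
      (Multiset.map (fun l => (m l, d l)) Finset.univ.val)).sum := by
  rw [Multiset.map_map]
  rfl

/-- **Uniqueness of the barcode decomposition**: if a finitely generated `ℤ`-graded
`F[t]`-module `M` is isomorphic to two direct sums
`(⊕_q t^{n q}·F[t]) ⊕ (⊕_l (t^{m l}·F[t])/(t^{m l + d l}))` and
`(⊕_q t^{n' q}·F[t]) ⊕ (⊕_l (t^{m' l}·F[t])/(t^{m' l + d' l}))` with all `d l, d' l`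
positive, then `Q = Q'`, `L = L'`, and the multisets `{n q}` and `{(m l, d l)}` agree;
hence the barcode is a complete invariant of the graded isomorphism type of `M`. -/
theorem graded_module_barcode_unique (M : GrMod F) (hM : M.FG)
    {Q L Q' L' : ℕ} (n : Fin Q → ℤ) (m : Fin L → ℤ) (d : Fin L → ℕ)
    (n' : Fin Q' → ℤ) (m' : Fin L' → ℤ) (d' : Fin L' → ℕ)
    (hd : ∀ l, 0 < d l) (hd' : ∀ l, 0 < d' l)
    (h₁ : M.Iso (barcodeGrMod F n m d)) (h₂ : M.Iso (barcodeGrMod F n' m' d')) :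
    Q = Q' ∧ L = L' ∧
      Multiset.map n Finset.univ.val = Multiset.map n' Finset.univ.val ∧
      Multiset.map (fun l => (m l, d l)) Finset.univ.val
        = Multiset.map (fun l => (m' l, d' l)) Finset.univ.val := by
  have hpairs : Multiset.map (fun l => (m l, d l)) Finset.univ.val
        = Multiset.map (fun l => (m' l, d' l)) Finset.univ.val := by
    refine Multiset.ext.2 ?_
    rintro ⟨a, b⟩
    rcases b with _ | b
    · rw [bar_count_zero m d hd, bar_count_zero m' d' hd']
    · have e1 := bar_count_pair (F := F) n m d a b
      have e2 := bar_count_pair (F := F) n' m' d' a b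
      simp only [← barKer_iso h₁] at e1
      simp only [← barKer_iso h₂] at e2
      omega
  have hP : ∀ j : ℤ, (∑ q, if n q ≤ j then 1 else 0) = ∑ q, if n' q ≤ j then 1 else 0 := by
    intro j
    obtain ⟨e, -⟩ := h₁
    obtain ⟨e', -⟩ := h₂
    have e1 := (e j).finrank_eq
    have e2 := (e' j).finrank_eq
    rw [barDim, bar_sum_map] at e1 e2
    rw [hpairs] at e1
    omega
  have hfree : Multiset.map n Finset.univ.val = Multiset.map n' Finset.univ.val := by
    refine Multiset.ext.2 fun a => ?_
    have e1 := bar_count_free n a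
    have e2 := bar_count_free n' a
    rw [hP, hP] at e1
    omega
  refine ⟨?_, ?_, hfree, hpairs⟩
  · simpa using congrArg Multiset.card hfree
  · simpa using congrArg Multiset.card hpairs
end

section
/- Let F be a field and let V be a persistence module over ℝ, i.e. a functor from the poset (ℝ, ≤), viewed as a category, to F-vector spaces, which is pointwise finite-dimensional: dim_F V(ε) < ∞ for every ε ∈ ℝ. Then V is isomorphic to a direct sum of interval modules: there is a family (J_i)_{i∈I} of intervals (nonempty convex subsets) of ℝ such that V ≅ ⊕_{i∈I} I_{J_i}. -/
open scoped DirectSum Classical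

/-- A persistence module over a preorder `P`: a functor from the poset `P`, viewed as a
category, to `F`-vector spaces. -/
structure PersMod (P : Type) [Preorder P] (F : Type) [Field F] where
  space : P → Type
  [instAdd : ∀ p, AddCommGroup (space p)]
  [instMod : ∀ p, Module F (space p)]
  map : ∀ ⦃p q : P⦄, p ≤ q → (space p →ₗ[F] space q)
  map_self : ∀ p, map (le_refl p) = LinearMap.id
  map_trans : ∀ ⦃p q r : P⦄ (h₁ : p ≤ q) (h₂ : q ≤ r), map (h₁.trans h₂) = (map h₂) ∘ₗ (map h₁)

attribute [instance] PersMod.instAdd PersMod.instMod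

variable {F : Type} [Field F]

/-- The degree-`ε` component of the interval module on `J`: a copy of `F` if `ε ∈ J`,
and `0` otherwise. -/
abbrev IntervalSpace (F : Type) [Field F] (J : Set ℝ) (ε : ℝ) : Type := PLift (ε ∈ J) → F

/-- The structure map `I_J(ε ≤ ε')` of the interval module on `J`:
the identity of `F` if `ε, ε' ∈ J`, and `0` otherwise. -/
noncomputable def intervalMap (F : Type) [Field F] (J : Set ℝ) (ε ε' : ℝ) :
    IntervalSpace F J ε →ₗ[F] IntervalSpace F J ε' where
  toFun f := fun _ => if h : ε ∈ J then f ⟨h⟩ else 0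
  map_add' f g := by funext h'; dsimp; split <;> simp
  map_smul' c f := by funext h'; dsimp; split <;> simp

/-- `V ≅ ⊕ᵢ I_{J i}` : the persistence module `V` is isomorphic to the (pointwise) direct
sum of the interval modules on the sets `J i`, `i : I`, via pointwise linear equivalences
commuting with all structure maps. -/
def PersMod.IsIntervalDecomposition (V : PersMod ℝ F) {I : Type} (J : I → Set ℝ) : Prop :=
  ∃ e : ∀ ε : ℝ, V.space ε ≃ₗ[F] (Π₀ i : I, IntervalSpace F (J i) ε),
    ∀ ⦃ε ε' : ℝ⦄ (h : ε ≤ ε'),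
      (DFinsupp.mapRange.linearMap fun i => intervalMap F (J i) ε ε') ∘ₗ (e ε).toLinearMap
        = (e ε').toLinearMap ∘ₗ V.map h

/-- The transition maps of a persistence module form a directed system. -/
theorem PersMod.directedSystem {P : Type} [Preorder P] (V : PersMod P F) :
    DirectedSystem V.space (fun _ _ h => V.map h) where
  map_self := by
    intro i x
    rw [V.map_self]; rfl
  map_map := by
    intro k j i hij hjk x
    rw [V.map_trans hij hjk]; rfl

/-- Over a linear order with bottom `t`, a functional at `t` killing all kernels extends. -/
theorem PersMod.exists_extend {P : Type} [LinearOrder P] (V : PersMod P F) (t : P)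
    (ht : ∀ u, t ≤ u) (φ : V.space t →ₗ[F] F)
    (hφ : ∀ u x, V.map (ht u) x = 0 → φ x = 0) :
    ∃ ψ : ∀ u, V.space u →ₗ[F] F, ψ t = φ ∧
      ∀ ⦃u w⦄ (h : u ≤ w) x, ψ w (V.map h x) = ψ u x := by
  have := V.directedSystem
  have : Nonempty P := ⟨t⟩
  let f := fun (u w : P) (h : u ≤ w) => V.map h
  let o := Module.DirectLimit.of F P V.space f
  have hk : φ ∈ LinearMap.range (o t).dualMap := by
    rw [LinearMap.range_dualMap_eq_dualAnnihilator_ker, Submodule.mem_dualAnnihilator]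
    intro x hx
    obtain ⟨u, hu, h0⟩ := Module.DirectLimit.of.zero_exact (f := f) (LinearMap.mem_ker.1 hx)
    exact hφ u x h0
  obtain ⟨Ψ, hΨ⟩ := hk
  refine ⟨fun u => Ψ ∘ₗ o u, hΨ, ?_⟩
  intro u w h x
  show Ψ (o w (f u w h x)) = Ψ (o u x)
  rw [Module.DirectLimit.of_f]

/-- A vector at the bottom `t` which never dies is detected by a compatible functional. -/
theorem PersMod.exists_detect {P : Type} [LinearOrder P] (V : PersMod P F) (t : P)
    (ht : ∀ u, t ≤ u) (v : V.space t) (hv : ∀ u, V.map (ht u) v ≠ 0) :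
    ∃ ψ : ∀ u, V.space u →ₗ[F] F, ψ t v = 1 ∧
      ∀ ⦃u w⦄ (h : u ≤ w) x, ψ w (V.map h x) = ψ u x := by
  have := V.directedSystem
  have : Nonempty P := ⟨t⟩
  let f := fun (u w : P) (h : u ≤ w) => V.map h
  let o := Module.DirectLimit.of F P V.space f
  have hk : o t v ≠ 0 := by
    intro hx
    obtain ⟨u, hu, h0⟩ := Module.DirectLimit.of.zero_exact (f := f) hx
    exact hv u h0
  obtain ⟨Ψ, hΨ⟩ := Module.Projective.exists_dual_eq_one F hk
  refine ⟨fun u => Ψ ∘ₗ o u, hΨ, ?_⟩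
  intro u w h x
  show Ψ (o w (f u w h x)) = Ψ (o u x)
  rw [Module.DirectLimit.of_f]

/-- Restriction of a persistence module to a subset. -/
def PersMod.restrict {P : Type} [Preorder P] (V : PersMod P F) (U : Set P) : PersMod U F where
  space u := V.space u
  map _ _ h := V.map h
  map_self p := V.map_self p
  map_trans _ _ _ h₁ h₂ := V.map_trans h₁ h₂

/-- The dual of a persistence module, over the opposite order. -/
def PersMod.dual {P : Type} [Preorder P] (V : PersMod P F) : PersMod Pᵒᵈ F where
  space u := Module.Dual F (V.space (OrderDual.ofDual u))
  map _ _ h := (V.map (OrderDual.ofDual_le_ofDual.2 h)).dualMap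
  map_self p := by
    ext φ x
    simp [V.map_self]
  map_trans p q r h₁ h₂ := by
    ext φ x
    simp only [LinearMap.dualMap_apply, LinearMap.comp_apply]
    rw [V.map_trans (OrderDual.ofDual_le_ofDual.2 h₂) (OrderDual.ofDual_le_ofDual.2 h₁)]
    rfl

/-- Over a linear order with top `t`, a vector in all images lifts to a compatible family. -/
theorem PersMod.exists_lift {P : Type} [LinearOrder P] (V : PersMod P F)
    (hfd : ∀ p, FiniteDimensional F (V.space p)) (t : P)
    (ht : ∀ u, u ≤ t) (v : V.space t) (hv : ∀ u, ∃ y, V.map (ht u) y = v) :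
    ∃ w : ∀ u, V.space u, w t = v ∧ ∀ ⦃u u'⦄ (h : u ≤ u'), V.map h (w u) = w u' := by
  obtain ⟨ψ, h1, h2⟩ := V.dual.exists_extend (OrderDual.toDual t) (fun u => ht u.ofDual)
    (Module.Dual.eval F (V.space t) v) (by
      intro u φ h
      obtain ⟨y, rfl⟩ := hv u.ofDual
      exact LinearMap.congr_fun h y)
  have key : ∀ u : P, ∃ w : V.space u, Module.Dual.eval F (V.space u) w
      = ψ (OrderDual.toDual u) := fun u =>
    ⟨(Module.evalEquiv F (V.space u)).symm (ψ (OrderDual.toDual u)),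
      (Module.evalEquiv F (V.space u)).apply_symm_apply _⟩
  choose w hw using key
  refine ⟨w, ?_, ?_⟩
  · apply (Module.evalEquiv F (V.space t)).injective
    exact (hw t).trans h1
  · intro u u' h
    apply (Module.evalEquiv F (V.space u')).injective
    refine Eq.trans ?_ (hw u').symm
    ext φ
    have := h2 (u := OrderDual.toDual u') (w := OrderDual.toDual u) h φ
    exact (LinearMap.congr_fun (hw u) (φ ∘ₗ V.map h)).trans this

/-- An interval summand: an interval with a compatible family of vectors and functionals. -/
structure IntervalDatum (V : PersMod ℝ F) where
  J : Set ℝ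
  v : ∀ s, V.space s
  g : ∀ s, V.space s →ₗ[F] F
  ne : J.Nonempty
  conv : J.OrdConnected
  v_zero : ∀ s, s ∉ J → v s = 0
  g_zero : ∀ s, s ∉ J → g s = 0
  gv : ∀ s, s ∈ J → g s (v s) = 1
  v_map : ∀ ⦃s s'⦄ (h : s ≤ s'), s ∈ J → V.map h (v s) = v s'
  g_map : ∀ ⦃s s'⦄ (h : s ≤ s'), s' ∈ J → ∀ x, g s' (V.map h x) = g s x

theorem PersMod.map_map_apply {P : Type} [Preorder P] (V : PersMod P F) {p q r : P}
    (h₁ : p ≤ q) (h₂ : q ≤ r) (x : V.space p) :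
    V.map h₂ (V.map h₁ x) = V.map (h₁.trans h₂) x := by
  rw [V.map_trans h₁ h₂]; rfl

theorem PersMod.map_self_apply {P : Type} [Preorder P] (V : PersMod P F) {p : P}
    (h : p ≤ p) (x : V.space p) : V.map h x = x := by
  rw [V.map_self]; rfl

/-- A nonzero pointwise finite-dimensional module has an interval summand. -/
theorem PersMod.exists_datum (V : PersMod ℝ F) (hfd : ∀ p, FiniteDimensional F (V.space p))
    (t : ℝ) (z : V.space t) (hz : z ≠ 0) : Nonempty (IntervalDatum V) := by
  let D : Set ℝ := {s | ∃ h : s ≤ t, V.map h ≠ 0}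
  have htD : t ∈ D := ⟨le_refl t, fun h => hz (by
    have := LinearMap.congr_fun h z
    rwa [V.map_self_apply] at this)⟩
  have hDle : ∀ s : D, (s : ℝ) ≤ t := fun s => s.2.1
  let r : D → ℕ := fun s => Module.finrank F (LinearMap.range (V.map (hDle s)))
  have : Nonempty D := ⟨⟨t, htD⟩⟩
  obtain ⟨s0, hs0⟩ : ∃ s0 : D, ∀ s, r s0 ≤ r s :=
    ⟨Function.argmin r, fun s => Function.argmin_le r s⟩
  have hrange : ∀ s : D, LinearMap.range (V.map (hDle s0)) ≤ LinearMap.range (V.map (hDle s)) := by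
    intro s
    rcases le_total s0 s with h | h
    · rintro _ ⟨x, rfl⟩
      exact ⟨V.map h x, V.map_map_apply _ _ _⟩
    · have hle : LinearMap.range (V.map (hDle s)) ≤ LinearMap.range (V.map (hDle s0)) := by
        rintro _ ⟨x, rfl⟩
        exact ⟨V.map h x, V.map_map_apply _ _ _⟩
      exact (Submodule.eq_of_le_of_finrank_le hle (hs0 s)).ge
  obtain ⟨y0, hy0⟩ : ∃ y, V.map (hDle s0) y ≠ 0 := by
    by_contra! hcon
    obtain ⟨h, h'⟩ := s0.2
    exact h' (LinearMap.ext hcon)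
  set vt := V.map (hDle s0) y0 with hvt
  -- vectors below `t`
  obtain ⟨w, hw1, hw2⟩ := (V.restrict D).exists_lift (fun p => hfd p) ⟨t, htD⟩ hDle vt
    (fun u => hrange u ⟨y0, rfl⟩)
  -- functionals above `t`
  let U : Set ℝ := {u | ∃ h : t ≤ u, V.map h vt ≠ 0}
  have htU : t ∈ U := ⟨le_refl t, by rwa [V.map_self_apply]⟩
  obtain ⟨ψ, hψ1, hψ2⟩ := (V.restrict U).exists_detect ⟨t, htU⟩ (fun u => u.2.1) vt
    (fun u => u.2.2)
  have hw2' : ∀ {s s' : ℝ} (hs : s ∈ D) (hs' : s' ∈ D) (h : s ≤ s'),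
      V.map h (w ⟨s, hs⟩) = w ⟨s', hs'⟩ := fun hs hs' h => hw2 (u := ⟨_, hs⟩) (u' := ⟨_, hs'⟩) h
  have hψ2' : ∀ {s s' : ℝ} (hs : s ∈ U) (hs' : s' ∈ U) (h : s ≤ s') (x : V.space s),
      ψ ⟨s', hs'⟩ (V.map h x) = ψ ⟨s, hs⟩ x :=
    fun hs hs' h x => hψ2 (u := ⟨_, hs⟩) (w := ⟨_, hs'⟩) h x
  have hDup : ∀ {s s' : ℝ}, s ∈ D → s ≤ s' → s' ≤ t → s' ∈ D := by
    rintro s s' ⟨h, h'⟩ hss hst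
    refine ⟨hst, fun h0 => h' ?_⟩
    rw [V.map_trans hss hst, h0, LinearMap.zero_comp]
  have hUdown : ∀ {s s' : ℝ}, s' ∈ U → s ≤ s' → t ≤ s → s ∈ U := by
    rintro s s' ⟨h, h'⟩ hss hst
    refine ⟨hst, fun h0 => h' ?_⟩
    rw [← V.map_map_apply hst hss, h0, map_zero]
  have hUD : ∀ {s : ℝ}, s ≤ t → s ∈ U → s ∈ D := by
    intro s h h'
    obtain rfl : s = t := le_antisymm h h'.1
    exact htD
  let v : ∀ s, V.space s := fun s =>
    if h : t ≤ s then V.map h vt else if h : s ∈ D then w ⟨s, h⟩ else 0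
  let g : ∀ s, V.space s →ₗ[F] F := fun s =>
    if h : s ≤ t then (ψ ⟨t, htU⟩ : V.space t →ₗ[F] F) ∘ₗ V.map h
      else if h : s ∈ U then ψ ⟨s, h⟩ else 0
  have hvU : ∀ s (h : t ≤ s), v s = V.map h vt := fun s h => dif_pos h
  have hvD : ∀ s (h : s ∈ D), v s = w ⟨s, h⟩ := by
    intro s h
    by_cases h' : t ≤ s
    · obtain rfl : s = t := le_antisymm h.1 h'
      rw [hvU _ h', V.map_self_apply]; exact hw1.symm
    · exact (dif_neg h').trans (dif_pos h)
  have hgD : ∀ s (h : s ≤ t) x, g s x = ψ ⟨t, htU⟩ (V.map h x) := by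
    intro s h x
    simp only [g, dif_pos h]; rfl
  have hgU : ∀ s (h : s ∈ U) x, g s x = ψ ⟨s, h⟩ x := by
    intro s h x
    by_cases h' : s ≤ t
    · obtain rfl : s = t := le_antisymm h' h.1
      rw [hgD _ h', V.map_self_apply]
    · exact LinearMap.congr_fun ((dif_neg h').trans (dif_pos h)) x
  refine ⟨⟨D ∪ U, v, g, ⟨t, Or.inl htD⟩, ⟨?_⟩, ?_, ?_, ?_, ?_, ?_⟩⟩
  · intro a ha b hb c hc
    rcases le_total c t with h | h
    · left
      rcases ha with ha | ha
      · exact hDup ha hc.1 h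
      · exact hDup (hUD (hc.1.trans h) ha) hc.1 h
    · right
      rcases hb with hb | hb
      · have : c = t := le_antisymm (hc.2.trans hb.1) h
        exact this ▸ htU
      · exact hUdown hb hc.2 h
  · intro s hs
    by_cases h : t ≤ s
    · rw [hvU s h]
      by_contra h0
      exact hs (Or.inr ⟨h, h0⟩)
    · have : s ∉ D := fun h => hs (Or.inl h)
      exact (dif_neg h).trans (dif_neg this)
  · intro s hs
    by_cases h : s ≤ t
    · have : V.map h = 0 := by
        by_contra h0
        exact hs (Or.inl ⟨h, h0⟩)
      ext x
      rw [hgD s h, this]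
      exact map_zero (ψ ⟨t, htU⟩)
    · have : s ∉ U := fun h => hs (Or.inr h)
      exact (dif_neg h).trans (dif_neg this)
  · rintro s (hs | hs)
    · rw [hgD s hs.1, hvD s hs, hw2' hs htD hs.1, hw1, hψ1]
    · rw [hgU s hs, hvU s hs.1, hψ2' htU hs hs.1, hψ1]
  · intro s s' h hs
    rcases le_total t s with hts | hts
    · rw [hvU s hts, hvU s' (hts.trans h), V.map_map_apply]
    · have hsD : s ∈ D := by
        rcases hs with hs | hs
        · exact hs
        · exact hUD hts hs
      rcases le_total t s' with h' | h'
      · rw [hvU s' h', ← V.map_map_apply hts h', hvD s hsD, hw2' hsD htD hts, hw1]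
      · rw [hvD s hsD, hvD s' (hDup hsD h h'), hw2' hsD]
  · intro s s' h hs x
    rcases le_total s' t with hts | hts
    · rw [hgD s' hts, hgD s (h.trans hts), V.map_map_apply]
    · have hsU : s' ∈ U := by
        rcases hs with hs | hs
        · have : s' = t := le_antisymm hs.1 hts
          exact this ▸ htU
        · exact hs
      rcases le_total s t with h' | h'
      · rw [hgU s' hsU, hgD s h', ← V.map_map_apply h' hts, hψ2' htU hsU hts]
      · rw [hgU s' hsU, hgU s (hUdown hsU h h')]
        exact hψ2' _ hsU h x

/-- Orthogonality of interval data. -/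
def IntervalDatum.Orth {V : PersMod ℝ F} (d e : IntervalDatum V) : Prop :=
  ∀ s, d.g s (e.v s) = 0

/-- The rank one endomorphisms attached to an interval datum are natural. -/
theorem IntervalDatum.natural {V : PersMod ℝ F} (d : IntervalDatum V) {s s' : ℝ} (h : s ≤ s')
    (x : V.space s) : V.map h (d.g s x • d.v s) = d.g s' (V.map h x) • d.v s' := by
  by_cases hs : s ∈ d.J
  · rw [map_smul, d.v_map h hs]
    by_cases hs' : s' ∈ d.J
    · rw [d.g_map h hs']
    · rw [d.v_zero s' hs', smul_zero, smul_zero]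
  · rw [d.g_zero s hs]
    by_cases hs' : s' ∈ d.J
    · rw [d.g_map h hs', d.g_zero s hs]; simp
    · rw [d.g_zero s' hs']; simp

theorem IntervalDatum.g_v {V : PersMod ℝ F} {S : Set (IntervalDatum V)}
    (hS : S.Pairwise IntervalDatum.Orth) (i j : S) (s : ℝ) (hs : s ∈ j.1.J) :
    i.1.g s (j.1.v s) = if i = j then 1 else 0 := by
  split_ifs with h
  · subst h; exact i.1.gv s hs
  · exact hS i.2 j.2 (fun hij => h (Subtype.ext hij)) s

/-- Only finitely many orthogonal data live at a given point. -/
theorem IntervalDatum.finite {V : PersMod ℝ F} (hfd : ∀ p, FiniteDimensional F (V.space p))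
    {S : Set (IntervalDatum V)} (hS : S.Pairwise IntervalDatum.Orth) (s : ℝ) :
    {i : S | s ∈ i.1.J}.Finite := by
  have hli : LinearIndependent F (fun i : {i : S | s ∈ i.1.J} => i.1.1.v s) := by
    rw [linearIndependent_iff']
    intro T c hc i hi
    have := congrArg (i.1.1.g s) hc
    rw [map_sum, map_zero] at this
    rw [← this, Finset.sum_eq_single i]
    · rw [map_smul, i.1.1.gv s i.2, smul_eq_mul, mul_one]
    · intro j _ hj
      rw [map_smul, IntervalDatum.g_v hS _ _ s j.2, if_neg, smul_zero]
      exact fun h => hj (Subtype.ext h.symm)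
    · exact fun h => (h hi).elim
  have := hfd s
  exact Set.finite_coe_iff.1 hli.finite_of_isNoetherian

/-- **Interval decomposition of pointwise finite-dimensional persistence modules**
(Crawley-Boevey): every pointwise finite-dimensional persistence module over `ℝ` is
isomorphic to a direct sum of interval modules `I_{J i}`, where each `J i` is a
nonempty convex subset (an interval) of `ℝ`. -/
theorem interval_decomposition_of_pointwise_finiteDimensional
    (V : PersMod ℝ F) (hfd : ∀ ε : ℝ, FiniteDimensional F (V.space ε)) :
    ∃ (I : Type) (J : I → Set ℝ),
      (∀ i, (J i).Nonempty ∧ Convex ℝ (J i)) ∧ V.IsIntervalDecomposition J := by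
  obtain ⟨S, hSmax⟩ := zorn_subset {S : Set (IntervalDatum V) | S.Pairwise IntervalDatum.Orth}
    (fun c hc hchain => ⟨⋃₀ c, (Set.pairwise_sUnion hchain.directedOn).2 hc,
      fun s hs => Set.subset_sUnion_of_mem hs⟩)
  have hS : S.Pairwise IntervalDatum.Orth := hSmax.prop
  have hfin := IntervalDatum.finite hfd hS
  let T : ℝ → Finset S := fun s => (hfin s).toFinset
  have hT : ∀ s i, i ∈ T s ↔ s ∈ i.1.J := fun s i => by simp [T]
  -- the projector onto the span of the family
  let p : ∀ s, V.space s →ₗ[F] V.space s := fun s => ∑ i ∈ T s, (i.1.g s).smulRight (i.1.v s)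
  have hp : ∀ s x, p s x = ∑ i ∈ T s, i.1.g s x • i.1.v s := by
    intro s x; simp [p]
  have hp' : ∀ s x (T' : Finset S), T s ⊆ T' → p s x = ∑ i ∈ T', i.1.g s x • i.1.v s := by
    intro s x T' hT'
    rw [hp]
    refine Finset.sum_subset hT' fun i _ hi => ?_
    rw [i.1.v_zero s (fun h => hi ((hT s i).2 h)), smul_zero]
  have hpnat : ∀ ⦃s s'⦄ (h : s ≤ s') x, V.map h (p s x) = p s' (V.map h x) := by
    intro s s' h x
    rw [hp' s x (T s ∪ T s') Finset.subset_union_left,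
      hp' s' _ (T s ∪ T s') Finset.subset_union_right, map_sum]
    exact Finset.sum_congr rfl fun i _ => i.1.natural h x
  have hgsum : ∀ s (i : S) (c : S → F), s ∈ i.1.J →
      i.1.g s (∑ j ∈ T s, c j • j.1.v s) = c i := by
    intro s i c hi
    rw [map_sum, Finset.sum_eq_single i]
    · rw [map_smul, i.1.gv s hi, smul_eq_mul, mul_one]
    · intro j hj hji
      rw [map_smul, IntervalDatum.g_v hS _ _ s ((hT s j).1 hj), if_neg hji.symm, smul_zero]
    · exact fun h => (h ((hT s i).2 hi)).elim
  have hgp : ∀ s (i : S) x, i.1.g s (p s x) = i.1.g s x := by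
    intro s i x
    by_cases hi : s ∈ i.1.J
    · rw [hp, hgsum s i (fun j => j.1.g s x) hi]
    · rw [i.1.g_zero s hi]; rfl
  -- the complement vanishes
  have hzero : ∀ s x, (∀ i : S, i.1.g s x = 0) → x = 0 := by
    by_contra! hcon
    obtain ⟨t, z, hz, hz0⟩ := hcon
    let Bs : ∀ s, Submodule F (V.space s) := fun s => ⨅ i : S, LinearMap.ker (i.1.g s)
    have hB : ∀ s x, x ∈ Bs s ↔ ∀ i : S, i.1.g s x = 0 := by
      intro s x; simp [Bs]
    have hBmap : ∀ ⦃s s'⦄ (h : s ≤ s'), ∀ x ∈ Bs s, V.map h x ∈ Bs s' := by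
      intro s s' h x hx
      rw [hB] at hx ⊢
      intro i
      by_cases hi : s' ∈ i.1.J
      · rw [i.1.g_map h hi, hx i]
      · rw [i.1.g_zero s' hi]; rfl
    let B : PersMod ℝ F :=
      { space := fun s => Bs s
        map := fun s s' h => (V.map h).restrict (hBmap h)
        map_self := by
          intro s; ext x; exact V.map_self_apply _ _
        map_trans := by
          intro p q r h₁ h₂; ext x; exact (V.map_map_apply h₁ h₂ _).symm }
    let π : ∀ s, V.space s →ₗ[F] B.space s := fun s =>
      (LinearMap.id - p s).codRestrict (Bs s) (by
        intro x
        rw [hB]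
        intro i
        rw [LinearMap.sub_apply, map_sub, hgp]
        exact sub_self _)
    have hπ : ∀ s x, (show Bs s from π s x).1 = x - p s x := fun s x => rfl
    have hπnat : ∀ ⦃s s'⦄ (h : s ≤ s') x, π s' (V.map h x) = B.map h (π s x) := by
      intro s s' h x
      apply Subtype.ext
      show V.map h x - p s' (V.map h x) = V.map h (x - p s x)
      rw [map_sub, hpnat]
    have hπB : ∀ s (x : B.space s), π s (show Bs s from x).1 = x := by
      intro s x
      apply Subtype.ext
      have hx := (hB s _).1 (show Bs s from x).2
      show (show Bs s from x).1 - p s (show Bs s from x).1 = (show Bs s from x).1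
      rw [hp, Finset.sum_eq_zero, sub_zero]
      intro i _
      rw [hx i, zero_smul]
    have hπv : ∀ s (j : S), π s (j.1.v s) = 0 := by
      intro s j
      apply Subtype.ext
      show j.1.v s - p s (j.1.v s) = 0
      by_cases hj : s ∈ j.1.J
      · rw [hp, Finset.sum_eq_single j, j.1.gv s hj, one_smul, sub_self]
        · intro i _ hij
          rw [IntervalDatum.g_v hS _ _ s hj, if_neg hij, zero_smul]
        · exact fun h => (h ((hT s j).2 hj)).elim
      · rw [j.1.v_zero s hj, map_zero, sub_zero]
    obtain ⟨d⟩ := B.exists_datum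
      (fun s => by have := hfd s; exact inferInstanceAs (FiniteDimensional F (Bs s))) t
      (⟨z, (hB t z).2 hz⟩ : Bs t) (fun h => hz0 (congrArg Subtype.val h))
    let d' : IntervalDatum V :=
      { J := d.J
        v := fun s => (show Bs s from d.v s).1
        g := fun s => d.g s ∘ₗ π s
        ne := d.ne
        conv := d.conv
        v_zero := fun s hs => congrArg Subtype.val (d.v_zero s hs)
        g_zero := fun s hs => by rw [d.g_zero s hs, LinearMap.zero_comp]
        gv := fun s hs => by
          rw [LinearMap.comp_apply, hπB, d.gv s hs]
        v_map := fun s s' h hs => congrArg Subtype.val (d.v_map h hs)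
        g_map := fun s s' h hs x => by
          rw [LinearMap.comp_apply, LinearMap.comp_apply, hπnat, d.g_map h hs] }
    have hort1 : ∀ i ∈ S, IntervalDatum.Orth i d' := fun i hi s =>
      (hB s _).1 (show Bs s from d.v s).2 ⟨i, hi⟩
    have hort2 : ∀ i ∈ S, IntervalDatum.Orth d' i := fun i hi s => by
      show d.g s (π s (i.v s)) = 0
      rw [hπv s ⟨i, hi⟩, map_zero]
    have hnot : d' ∉ S := by
      intro hd
      obtain ⟨s, hs⟩ := d'.ne
      exact one_ne_zero ((d'.gv s hs).symm.trans (hort1 d' hd s))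
    have hins : insert d' S ∈ {S : Set (IntervalDatum V) | S.Pairwise IntervalDatum.Orth} :=
      hS.insert fun i hi _ => ⟨hort2 i hi, hort1 i hi⟩
    exact hnot (hSmax.le_of_ge hins (Set.subset_insert _ _) (Set.mem_insert _ _))
  have hpid : ∀ s x, p s x = x := by
    intro s x
    refine sub_eq_zero.1 (hzero s _ fun i => ?_)
    rw [map_sub, hgp, sub_self]
  refine ⟨S, fun i => i.1.J, fun i => ⟨i.1.ne, i.1.conv.convex⟩, ?_⟩
  let toD : ∀ s, V.space s → (Π₀ i : S, IntervalSpace F (i.1.J) s) := fun s x =>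
    DFinsupp.mk (T s) (fun i _ => i.1.1.g s x)
  have hto : ∀ s x (i : S) h, toD s x i h = i.1.g s x := by
    intro s x i h
    have : i ∈ T s := (hT s i).2 h.down
    simp only [toD, DFinsupp.mk_apply, dif_pos this]
  refine ⟨fun s =>
    { toFun := toD s
      map_add' := fun x y => by
        ext i h
        rw [DFinsupp.add_apply, Pi.add_apply, hto, hto, hto, map_add]
      map_smul' := fun c x => by
        ext i h
        rw [DFinsupp.smul_apply, Pi.smul_apply, hto, hto, map_smul]; rfl
      invFun := fun f => ∑ i ∈ T s, (if h : s ∈ i.1.J then f i ⟨h⟩ else 0) • i.1.v s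
      left_inv := fun x => by
        refine Eq.trans ?_ (hpid s x)
        rw [hp]
        refine Finset.sum_congr rfl fun i hi => ?_
        rw [dif_pos ((hT s i).1 hi), hto]
      right_inv := fun f => by
        ext i h
        rw [hto, hgsum s i (fun i => if h : s ∈ i.1.J then f i ⟨h⟩ else 0) h.down,
          dif_pos h.down] }, ?_⟩
  intro s s' h
  refine LinearMap.ext fun x => DFinsupp.ext fun i => funext fun h' => ?_
  show (if hs : s ∈ i.1.J then toD s x i ⟨hs⟩ else 0) = toD s' (V.map h x) i h'
  rw [hto, i.1.g_map h h'.down]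
  split_ifs with hs
  · rw [hto]
  · rw [i.1.g_zero s hs]; rfl
end

section
/- Let F be a field and let V, W be functors from the poset (ℤ, ≤), viewed as a category, to finite-dimensional F-vector spaces, each nonzero in only finitely many degrees. If V and W have the same rank invariant, i.e. rank V(j ≤ j') = rank W(j ≤ j') for all pairs j ≤ j' in ℤ, then V and W are isomorphic as functors. That is, the rank invariant is a complete isomorphism invariant for one-dimensional persistence. -/
open scoped DirectSum Classical

variable {F : Type} [Field F]

/-- Isomorphism of persistence modules: pointwise linear equivalences commuting with
the structure maps (i.e. a natural isomorphism of functors). -/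
def PersMod.Iso {P : Type} [Preorder P] (V W : PersMod P F) : Prop :=
  ∃ e : ∀ p, V.space p ≃ₗ[F] W.space p,
    ∀ ⦃p q : P⦄ (h : p ≤ q),
      (e q).toLinearMap ∘ₗ V.map h = W.map h ∘ₗ (e p).toLinearMap

/-- One-vector extension. -/
theorem ext_one {A A' B : Type} [AddCommGroup A] [Module F A] [AddCommGroup A'] [Module F A']
    [AddCommGroup B] [Module F B] (f : A →ₗ[F] B) (g : A' →ₗ[F] B)
    (S : Submodule F A) (e : A →ₗ[F] A') (x : A) (x' : A') (hx : x ∉ S) (hx' : x' ∉ S.map e)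
    (hfg : g x' = f x) (hinj : ∀ s ∈ S, e s = 0 → s = 0) (hc : ∀ s ∈ S, g (e s) = f s) :
    ∃ e' : A →ₗ[F] A', (∀ s ∈ S, e' s = e s) ∧ e' x = x' ∧
      (∀ s ∈ S ⊔ Submodule.span F {x}, e' s = 0 → s = 0) ∧
      (∀ s ∈ S ⊔ Submodule.span F {x}, g (e' s) = f s) := by
  obtain ⟨ψ, hψ, hS⟩ := Submodule.exists_le_ker_of_notMem hx
  let e' : A →ₗ[F] A' := e + (ψ.smulRight ((ψ x)⁻¹ • (x' - e x)))
  have h1 : ∀ s ∈ S, e' s = e s := by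
    intro s hs
    have : ψ s = 0 := hS hs
    simp [e', this]
  have h2 : e' x = x' := by
    simp [e', smul_smul, hψ]
  refine ⟨e', h1, h2, ?_, ?_⟩
  · intro s hs h0
    obtain ⟨y, hy, z, hz, rfl⟩ := Submodule.mem_sup.1 hs
    obtain ⟨c, rfl⟩ := Submodule.mem_span_singleton.1 hz
    rw [map_add, map_smul, h1 y hy, h2] at h0
    by_cases hc0 : c = 0
    · subst hc0
      simp at h0 ⊢
      exact hinj y hy h0
    · exfalso
      apply hx'
      have : x' = c⁻¹ • (-(e y)) := by
        rw [← eq_neg_of_add_eq_zero_right h0, smul_smul, inv_mul_cancel₀ hc0, one_smul]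
      rw [this]
      exact Submodule.smul_mem _ _ (Submodule.neg_mem _ (Submodule.mem_map_of_mem hy))
  · intro s hs
    obtain ⟨y, hy, z, hz, rfl⟩ := Submodule.mem_sup.1 hs
    obtain ⟨c, rfl⟩ := Submodule.mem_span_singleton.1 hz
    rw [map_add, map_smul, h1 y hy, h2, map_add, map_smul, hc y hy, hfg, map_add, map_smul]

theorem ext_sub {A A' B : Type} [AddCommGroup A] [Module F A] [AddCommGroup A'] [Module F A']
    [AddCommGroup B] [Module F B] [FiniteDimensional F A] [FiniteDimensional F A']
    (f : A →ₗ[F] B) (g : A' →ₗ[F] B)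
    (T : Submodule F A) (T' : Submodule F A') (hT : T.map f = T'.map g)
    (hd : Module.finrank F T = Module.finrank F T') (n : ℕ) :
    ∀ (S : Submodule F A) (_ : S ≤ T) (_ : Module.finrank F T ≤ Module.finrank F S + n)
    (e : A →ₗ[F] A') (_ : S.map e ≤ T') (_ : ∀ s ∈ S, e s = 0 → s = 0)
    (_ : ∀ s ∈ S, g (e s) = f s),
    ∃ e' : A →ₗ[F] A', (∀ s ∈ S, e' s = e s) ∧ T.map e' = T' ∧
      (∀ s ∈ T, e' s = 0 → s = 0) ∧ (∀ s ∈ T, g (e' s) = f s) := by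
  have frk : ∀ (S : Submodule F A) (e : A →ₗ[F] A'), (∀ s ∈ S, e s = 0 → s = 0) →
      Module.finrank F (S.map e) = Module.finrank F S := by
    intro S e h
    have hi : Function.Injective (e.domRestrict S) := by
      rw [injective_iff_map_eq_zero]
      intro a ha
      exact Subtype.ext (h a a.2 ha)
    rw [← LinearMap.finrank_range_of_inj hi, LinearMap.range_domRestrict]
  induction n with
  | zero =>
    intro S hST hn e hST' hinj hc
    have : S = T := Submodule.eq_of_le_of_finrank_le hST (by simpa using hn)
    subst this
    exact ⟨e, fun _ _ => rfl,
      Submodule.eq_of_le_of_finrank_eq hST' (by rw [frk S e hinj, hd]), hinj, hc⟩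
  | succ n ih =>
    intro S hST hn e hST' hinj hc
    by_cases hEq : S = T
    · subst hEq
      exact ⟨e, fun _ _ => rfl,
        Submodule.eq_of_le_of_finrank_eq hST' (by rw [frk S e hinj, hd]), hinj, hc⟩
    have hEq' : S.map e ≠ T' := by
      intro h
      apply hEq
      apply Submodule.eq_of_le_of_finrank_eq hST
      rw [← frk S e hinj, h, hd]
    obtain ⟨x, hxT, x', hxT', hx, hx', hfg⟩ : ∃ x ∈ T, ∃ x' ∈ T', x ∉ S ∧ x' ∉ S.map e ∧
        g x' = f x := by
      by_cases hle : T.map f ≤ S.map f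
      · obtain ⟨t, ht, htS⟩ := SetLike.exists_of_lt (lt_of_le_of_ne hST hEq)
        obtain ⟨t', ht', htS'⟩ := SetLike.exists_of_lt (lt_of_le_of_ne hST' hEq')
        obtain ⟨s, hs, hst⟩ := hle (Submodule.mem_map_of_mem ht)
        obtain ⟨s', hs', hst'⟩ := hle (hT ▸ Submodule.mem_map_of_mem (f := g) ht' : g t' ∈ T.map f)
        refine ⟨t - s, T.sub_mem ht (hST hs), t' - e s',
          T'.sub_mem ht' (hST' (Submodule.mem_map_of_mem hs')), ?_, ?_, ?_⟩
        · intro h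
          exact htS (by simpa using S.add_mem h hs)
        · intro h
          exact htS' (by simpa using (S.map e).add_mem h (Submodule.mem_map_of_mem hs'))
        · rw [map_sub, map_sub, hc s' hs', hst, hst', sub_self, sub_self]
      · obtain ⟨y, hy, hyS⟩ := SetLike.not_le_iff_exists.1 hle
        obtain ⟨x, hx, rfl⟩ := hy
        obtain ⟨x', hx', hxx⟩ := (hT ▸ Submodule.mem_map_of_mem (f := f) hx : f x ∈ T'.map g)
        refine ⟨x, hx, x', hx', fun h => hyS (Submodule.mem_map_of_mem h), ?_, hxx⟩
        rintro ⟨s, hs, rfl⟩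
        apply hyS
        rw [← hxx, hc s hs]
        exact Submodule.mem_map_of_mem hs
    obtain ⟨e₁, h1, h2, h3, h4⟩ := ext_one f g S e x x' hx hx' hfg hinj hc
    have hlt : S < S ⊔ Submodule.span F {x} := by
      refine lt_of_le_of_ne le_sup_left fun h => hx ?_
      rw [h]
      exact Submodule.mem_sup_right (Submodule.mem_span_singleton_self x)
    have hlt' := Submodule.finrank_lt_finrank_of_lt hlt
    obtain ⟨e', k1, k2⟩ := ih (S ⊔ Submodule.span F {x})
      (sup_le hST (by simpa using hxT)) (by omega) e₁ (by
        rw [Submodule.map_sup, Submodule.map_span]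
        refine sup_le ?_ ?_
        · rintro _ ⟨s, hs, rfl⟩
          rw [h1 s hs]
          exact hST' (Submodule.mem_map_of_mem hs)
        · simpa [h2] using hxT') h3 h4
    exact ⟨e', fun s hs => (k1 s (Submodule.mem_sup_left hs)).trans (h1 s hs), k2⟩

theorem ext_chain {A A' B : Type} [AddCommGroup A] [Module F A] [AddCommGroup A'] [Module F A']
    [AddCommGroup B] [Module F B] [FiniteDimensional F A] [FiniteDimensional F A']
    (f : A →ₗ[F] B) (g : A' →ₗ[F] B)
    (M : ℕ → Submodule F A) (M' : ℕ → Submodule F A') (hm : Monotone M) (hm' : Monotone M')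
    (h0 : M 0 = ⊥)
    (hT : ∀ n, (M n).map f = (M' n).map g)
    (hd : ∀ n, Module.finrank F (M n) = Module.finrank F (M' n)) (n : ℕ) :
    ∃ e : A →ₗ[F] A', (∀ i ≤ n, (M i).map e = M' i) ∧
      (∀ s ∈ M n, e s = 0 → s = 0) ∧ (∀ s ∈ M n, g (e s) = f s) := by
  induction n with
  | zero =>
    refine ⟨0, ?_, ?_, ?_⟩
    · intro i hi
      obtain rfl : i = 0 := by omega
      have := hd 0
      rw [h0, finrank_bot] at this
      rw [h0, Submodule.map_bot, Submodule.finrank_eq_zero.1 this.symm]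
    · intro s hs _
      simpa [h0] using hs
    · intro s hs
      have : s = 0 := by simpa [h0] using hs
      simp [this]
  | succ n ih =>
    obtain ⟨e, h1, h2, h3⟩ := ih
    obtain ⟨e', k1, k2, k3⟩ := ext_sub f g (M (n+1)) (M' (n+1)) (hT _) (hd _)
      (Module.finrank F (M (n+1))) (M n) (hm (Nat.le_succ n)) (by omega) e
      (by rw [h1 n le_rfl]; exact hm' (Nat.le_succ n)) h2 h3
    refine ⟨e', ?_, k3⟩
    intro i hi
    rcases Nat.lt_or_ge n i with h | h
    · obtain rfl : i = n + 1 := by omega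
      exact k2
    · rw [← h1 i h]
      ext y
      constructor
      · rintro ⟨s, hs, rfl⟩
        exact ⟨s, hs, (k1 s (hm h hs)).symm⟩
      · rintro ⟨s, hs, rfl⟩
        exact ⟨s, hs, k1 s (hm h hs)⟩

theorem PersMod.range_mono (V : PersMod ℤ F) {i k p : ℤ} (h : i ≤ k) (hk : k ≤ p) :
    LinearMap.range (V.map (h.trans hk)) ≤ LinearMap.range (V.map hk) := by
  rw [V.map_trans h hk]
  exact LinearMap.range_comp_le_range _ _

theorem pers_step (V W : PersMod ℤ F)
    (hVfd : ∀ j : ℤ, FiniteDimensional F (V.space j))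
    (hWfd : ∀ j : ℤ, FiniteDimensional F (W.space j))
    (hrank : ∀ ⦃j j' : ℤ⦄ (h : j ≤ j'),
      Module.finrank F (LinearMap.range (V.map h))
        = Module.finrank F (LinearMap.range (W.map h)))
    (a : ℤ) (ha : ∀ j ≤ a, Subsingleton (V.space j)) (ha' : ∀ j ≤ a, Subsingleton (W.space j))
    (p q : ℤ) (hpq : p ≤ q) (eq : V.space q →ₗ[F] W.space q)
    (heq : ∀ i (h : i ≤ q), (LinearMap.range (V.map h)).map eq = LinearMap.range (W.map h)) :
    ∃ e : V.space p →ₗ[F] W.space p, Function.Injective e ∧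
      (∀ i (h : i ≤ p), (LinearMap.range (V.map h)).map e = LinearMap.range (W.map h)) ∧
      eq ∘ₗ V.map hpq = W.map hpq ∘ₗ e := by
  have := hVfd p
  have := hWfd p
  have hmin : ∀ n : ℕ, min (a + n) p ≤ p := fun n => min_le_right _ _
  obtain ⟨e, h1, h2, h3⟩ := ext_chain (eq ∘ₗ V.map hpq) (W.map hpq)
    (fun n => LinearMap.range (V.map (hmin n))) (fun n => LinearMap.range (W.map (hmin n)))
    (fun m n h => V.range_mono (by omega) (hmin n))
    (fun m n h => W.range_mono (by omega) (hmin n))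
    (by
      have := ha (min (a + (0:ℕ)) p) (by omega)
      rw [LinearMap.range_eq_bot]
      exact Subsingleton.elim _ _)
    (fun n => by
      rw [Submodule.map_comp, ← LinearMap.range_comp (V.map (hmin n)) (V.map hpq),
        ← LinearMap.range_comp (W.map (hmin n)) (W.map hpq), ← V.map_trans, ← W.map_trans]
      exact heq _ _)
    (fun n => hrank _) (p - a).toNat
  have htop : ∀ s, s ∈ LinearMap.range (V.map (hmin (p - a).toNat)) := by
    have key : ∀ k (h : k ≤ p), k = p → LinearMap.range (V.map h) = ⊤ := by
      rintro k h rfl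
      rw [V.map_self, LinearMap.range_id]
    intro s
    rw [key _ _ (by omega)]
    trivial
  refine ⟨e, ?_, ?_, ?_⟩
  · rw [injective_iff_map_eq_zero]
    exact fun s hs => h2 s (htop s) hs
  · intro i h
    rcases le_total i a with hi | hi
    · have := ha i hi
      have := ha' i hi
      rw [Subsingleton.elim (V.map h) 0, Subsingleton.elim (W.map h) 0]
      simp
    · have key : ∀ k (hk : k ≤ p), k = i →
        (LinearMap.range (V.map hk)).map e = LinearMap.range (W.map hk) →
        (LinearMap.range (V.map h)).map e = LinearMap.range (W.map h) := by
        rintro k hk rfl H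
        exact H
      exact key _ (hmin (i - a).toNat) (by omega) (h1 _ (by omega))
  · ext s
    exact (h3 s (htop s)).symm

theorem pers_family (V W : PersMod ℤ F)
    (hVfd : ∀ j : ℤ, FiniteDimensional F (V.space j))
    (hWfd : ∀ j : ℤ, FiniteDimensional F (W.space j))
    (hrank : ∀ ⦃j j' : ℤ⦄ (h : j ≤ j'),
      Module.finrank F (LinearMap.range (V.map h))
        = Module.finrank F (LinearMap.range (W.map h)))
    (a : ℤ) (ha : ∀ j ≤ a, Subsingleton (V.space j)) (ha' : ∀ j ≤ a, Subsingleton (W.space j))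
    (b : ℤ) (hb : ∀ j ≥ b, Subsingleton (V.space j)) (hb' : ∀ j ≥ b, Subsingleton (W.space j))
    (n : ℕ) :
    ∃ e : ∀ p, V.space p →ₗ[F] W.space p, ∀ p ≥ b - n, Function.Injective (e p) ∧
      (∀ i (h : i ≤ p), (LinearMap.range (V.map h)).map (e p) = LinearMap.range (W.map h)) ∧
      ∀ q (h : p ≤ q), e q ∘ₗ V.map h = W.map h ∘ₗ e p := by
  induction n with
  | zero =>
    refine ⟨fun _ => 0, fun p hp => ?_⟩
    have := hb p (by simpa using hp)
    have := hb' p (by simpa using hp)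
    refine ⟨Function.injective_of_subsingleton _, ?_, ?_⟩
    · intro i h
      exact Subsingleton.elim _ _
    · intro q h
      simp
  | succ n ih =>
    obtain ⟨e, he⟩ := ih
    obtain ⟨p, hp⟩ : ∃ p, p = b - n - 1 := ⟨_, rfl⟩
    obtain ⟨e₀, k1, k2, k3⟩ := pers_step V W hVfd hWfd hrank a ha ha' p (p + 1) (by omega)
      (e (p + 1)) (he (p + 1) (by omega)).2.1
    refine ⟨Function.update e p e₀, fun r hr => ?_⟩
    by_cases hrp : r = p
    · subst hrp
      rw [Function.update_self]
      refine ⟨k1, k2, fun q h => ?_⟩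
      by_cases hq : q = r
      · subst hq
        rw [Function.update_self, V.map_self, W.map_self]
        rfl
      · rw [Function.update_of_ne hq]
        have h' : r + 1 ≤ q := by omega
        have h'' : r ≤ r + 1 := by omega
        rw [V.map_trans h'' h', W.map_trans h'' h', LinearMap.comp_assoc, ← k3,
          ← LinearMap.comp_assoc, ← LinearMap.comp_assoc, (he (r + 1) (by omega)).2.2 q h']
    · have hr' : r ≥ b - n := by push_cast at hr; omega
      rw [Function.update_of_ne hrp]
      refine ⟨(he r hr').1, (he r hr').2.1, fun q h => ?_⟩
      rw [Function.update_of_ne (by omega)]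
      exact (he r hr').2.2 q h

/-- **The rank invariant is a complete invariant for one-dimensional persistence**:
if `V, W` are pointwise finite-dimensional `ℤ`-indexed persistence modules, each nonzero
in only finitely many degrees, and `rank V(j ≤ j') = rank W(j ≤ j')` for all `j ≤ j'`,
then `V ≅ W`. -/
theorem rank_invariant_complete
    (V W : PersMod ℤ F)
    (hVfd : ∀ j : ℤ, FiniteDimensional F (V.space j))
    (hWfd : ∀ j : ℤ, FiniteDimensional F (W.space j))
    (hVfin : {j : ℤ | Nontrivial (V.space j)}.Finite)
    (hWfin : {j : ℤ | Nontrivial (W.space j)}.Finite)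
    (hrank : ∀ ⦃j j' : ℤ⦄ (h : j ≤ j'),
      Module.finrank F (LinearMap.range (V.map h))
        = Module.finrank F (LinearMap.range (W.map h))) :
    V.Iso W := by
  obtain ⟨b₁, hb₁⟩ := (hVfin.union hWfin).bddAbove
  obtain ⟨a₁, ha₁⟩ := (hVfin.union hWfin).bddBelow
  have ha : ∀ j ≤ a₁ - 1, Subsingleton (V.space j) := fun j hj =>
    not_nontrivial_iff_subsingleton.1 fun h => by
      have := ha₁ (Or.inl h : j ∈ _)
      omega
  have ha' : ∀ j ≤ a₁ - 1, Subsingleton (W.space j) := fun j hj =>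
    not_nontrivial_iff_subsingleton.1 fun h => by
      have := ha₁ (Or.inr h : j ∈ _)
      omega
  have hb : ∀ j ≥ b₁ + 1, Subsingleton (V.space j) := fun j hj =>
    not_nontrivial_iff_subsingleton.1 fun h => by
      have := hb₁ (Or.inl h : j ∈ _)
      omega
  have hb' : ∀ j ≥ b₁ + 1, Subsingleton (W.space j) := fun j hj =>
    not_nontrivial_iff_subsingleton.1 fun h => by
      have := hb₁ (Or.inr h : j ∈ _)
      omega
  obtain ⟨e, he⟩ := pers_family V W hVfd hWfd hrank _ ha ha' _ hb hb' (b₁ + 1 - (a₁ - 1)).toNat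
  have hinj : ∀ p, Function.Injective (e p) := by
    intro p
    rcases le_total p (a₁ - 1) with h | h
    · have := ha p h
      exact Function.injective_of_subsingleton _
    · exact (he p (by omega)).1
  have hdim : ∀ p, Module.finrank F (V.space p) = Module.finrank F (W.space p) := by
    intro p
    have := hrank (le_refl p)
    rwa [V.map_self, W.map_self, LinearMap.range_id, LinearMap.range_id, finrank_top,
      finrank_top] at this
  refine ⟨fun p => LinearEquiv.ofBijective (e p) ⟨hinj p,
    (LinearMap.injective_iff_surjective_of_finrank_eq_finrank (hdim p)).1 (hinj p)⟩, ?_⟩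
  intro p q h
  ext x
  change e q (V.map h x) = W.map h (e p x)
  rcases le_total p (a₁ - 1) with hp | hp
  · have := ha p hp
    rw [Subsingleton.elim x 0]
    simp
  · exact LinearMap.congr_fun ((he p (by omega)).2.2 q h) x
end

section
/- Let F be a field. There exists a family (V_λ), indexed by λ ∈ F ∖ {0, 1}, of functors from the poset ℤ² (with the product order: (u₁,u₂) ⪯ (v₁,v₂) iff u₁ ≤ v₁ and u₂ ≤ v₂) to finite-dimensional F-vector spaces, such that: (i) for every u ∈ ℤ², the dimension dim_F V_λ(u) is the same for all λ; and (ii) for λ ≠ μ, the functors V_λ and V_μ are not isomorphic. Consequently, when F is infinite there are infinitely many isomorphism classes of pointwise finite-dimensional ℤ²-indexed persistence modules sharing the same pointwise dimension function, so no complete discrete invariant exists for multidimensional persistence. -/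
open scoped DirectSum Classical

variable {F : Type} [Field F]

/-- The four spanning vectors; only the last one depends on the parameter. -/
noncomputable def fourVec {F : Type} [Field F] (l : F) (i : ℤ) : F × F :=
  if i = 0 then (1, 0) else if i = 1 then (0, 1) else if i = 2 then (1, 1)
  else if i = 3 then (1, l) else 0

/-- Monotone family of subspaces of `F²`: zero below the antidiagonal, lines on it,
everything above it. -/
noncomputable def fourSub {F : Type} [Field F] (l : F) (u : ℤ × ℤ) : Submodule F (F × F) :=
  if u.1 + u.2 < 0 then ⊥ else if u.1 + u.2 = 0 then Submodule.span F {fourVec l u.1} else ⊤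

theorem fourSub_mono {F : Type} [Field F] (l : F) {u v : ℤ × ℤ} (h : u ≤ v) :
    fourSub l u ≤ fourSub l v := by
  obtain ⟨a, b⟩ := u
  obtain ⟨c, d⟩ := v
  obtain ⟨h1, h2⟩ := h
  simp only at h1 h2
  unfold fourSub
  simp only
  by_cases hu : a + b < 0
  · simp [hu]
  by_cases hv : c + d = 0
  · obtain rfl : a = c := by omega
    obtain rfl : b = d := by omega
    exact le_rfl
  · have : ¬ c + d < 0 := by omega
    simp [hv, this]

/-- The module with spaces `fourSub l u` and inclusions as structure maps. -/
noncomputable def fourMod {F : Type} [Field F] (l : F) : PersMod (ℤ × ℤ) F where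
  space u := fourSub l u
  map _ _ h := Submodule.inclusion (fourSub_mono l h)
  map_self _ := rfl
  map_trans _ _ _ _ _ := rfl

theorem fourSub_finrank {F : Type} [Field F] (l l' : F) (u : ℤ × ℤ) :
    Module.finrank F (fourSub l u) = Module.finrank F (fourSub l' u) := by
  by_cases h : u.1 + u.2 = 0 ∧ u.1 = 3
  · obtain ⟨h1, h3⟩ := h
    have hm : ∀ m : F, fourSub m u = Submodule.span F {((1, m) : F × F)} :=
      fun m => by
        unfold fourSub
        rw [h1]
        simp [fourVec, h3]
    rw [hm, hm, finrank_span_singleton, finrank_span_singleton] <;> simp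
  · have : fourSub l u = fourSub l' u := by
      by_cases h1 : u.1 + u.2 = 0
      · have h3 : u.1 ≠ 3 := fun h3 => h ⟨h1, h3⟩
        simp [fourSub, fourVec, h3]
      · simp [fourSub, h1]
    rw [this]

theorem fourMod_iso {F : Type} [Field F] (l l' : F) (h : (fourMod l).Iso (fourMod l')) :
    l = l' := by
  obtain ⟨e, he⟩ := h
  have top : ∀ m : F, fourSub m ((4, 4) : ℤ × ℤ) = ⊤ := fun m => by simp [fourSub]
  have hx : ∀ x : F × F, x ∈ fourSub l ((4, 4) : ℤ × ℤ) := fun x => by simp [top]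
  let e4 : fourSub l ((4, 4) : ℤ × ℤ) ≃ₗ[F] fourSub l' ((4, 4) : ℤ × ℤ) := e (4, 4)
  let g : F × F →ₗ[F] F × F :=
    (fourSub l' ((4, 4) : ℤ × ℤ)).subtype ∘ₗ e4.toLinearMap ∘ₗ
      LinearMap.codRestrict (fourSub l ((4, 4) : ℤ × ℤ)) LinearMap.id hx
  have ginj : ∀ x, g x = 0 → x = 0 := by
    intro x h0
    have h1 : e4 ⟨x, hx x⟩ = 0 := Subtype.ext h0
    have h2 := (LinearEquiv.map_eq_zero_iff e4).1 h1
    exact congrArg Subtype.val h2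
  have key : ∀ i : ℤ, i ≤ 4 → -i ≤ 4 → ∃ c : F, c • fourVec l' i = g (fourVec l i) := by
    intro i h1 h2
    have hp : ((i, -i) : ℤ × ℤ) ≤ (4, 4) := ⟨h1, h2⟩
    have hm : ∀ m : F, fourSub m ((i, -i) : ℤ × ℤ) = Submodule.span F {fourVec m i} :=
      fun m => by simp [fourSub]
    have hmem : fourVec l i ∈ fourSub l ((i, -i) : ℤ × ℤ) := by
      rw [hm]; exact Submodule.mem_span_singleton_self _
    let y : fourSub l' ((i, -i) : ℤ × ℤ) := e (i, -i) ⟨fourVec l i, hmem⟩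
    have h3 := LinearMap.congr_fun (he hp) ⟨fourVec l i, hmem⟩
    have h4 : g (fourVec l i) = y.1 := congrArg Subtype.val h3
    have h5 : g (fourVec l i) ∈ fourSub l' ((i, -i) : ℤ × ℤ) := h4 ▸ y.2
    rw [hm] at h5
    exact Submodule.mem_span_singleton.1 h5
  obtain ⟨a, ha⟩ := key 0 (by norm_num) (by norm_num)
  obtain ⟨b, hb⟩ := key 1 (by norm_num) (by norm_num)
  obtain ⟨c, hc⟩ := key 2 (by norm_num) (by norm_num)
  obtain ⟨d, hd⟩ := key 3 (by norm_num) (by norm_num)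
  norm_num [fourVec] at ha hb hc hd
  have e2 : ((1, 1) : F × F) = (1, 0) + (0, 1) := by simp
  have e3 : ((1, l) : F × F) = (1, 0) + l • (0, 1) := by simp
  rw [e2, map_add, ← ha, ← hb] at hc
  rw [e3, map_add, map_smul, ← ha, ← hb] at hd
  simp at hc hd
  have ha0 : a ≠ 0 := by
    rintro rfl
    have := ginj (1, 0) (by rw [← ha]; rfl)
    simp at this
  obtain ⟨rfl, rfl⟩ := hc
  obtain ⟨rfl, h⟩ := hd
  have h' : d * l' = d * l := by rw [h, mul_comm]
  exact (mul_left_cancel₀ ha0 h').symm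

/-- **No complete discrete invariant for multidimensional persistence**
(Carlsson–Zomorodian): there is a family of pointwise finite-dimensional
`ℤ²`-indexed persistence modules, indexed by `λ ∈ F ∖ {0, 1}`, all having the same
pointwise dimension function, but pairwise nonisomorphic. -/
theorem exists_multiD_family_same_dims_not_iso (F : Type) [Field F] :
    ∃ V : {l : F // l ≠ 0 ∧ l ≠ 1} → PersMod (ℤ × ℤ) F,
      (∀ l u, FiniteDimensional F ((V l).space u)) ∧
      (∀ l l' u, Module.finrank F ((V l).space u) = Module.finrank F ((V l').space u)) ∧
      (∀ l l', l ≠ l' → ¬ (V l).Iso (V l')) := by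
  refine ⟨fun l => fourMod l.1, ?_, ?_, ?_⟩
  · intro l u
    exact inferInstanceAs (FiniteDimensional F (fourSub l.1 u))
  · intro l l' u
    exact fourSub_finrank l.1 l'.1 u
  · intro l l' hne h
    exact hne (Subtype.ext (fourMod_iso l.1 l'.1 h))
end

section
/- Let F be a field, n ≥ 1, and let τ : {1, …, n−1} → {left, right} be an orientation. Let P_τ be the fence (zigzag) partial order on {1, …, n} generated by declaring i ≤ i+1 when τ(i) = right and i+1 ≤ i when τ(i) = left. Then every functor V from the poset P_τ, viewed as a category, to finite-dimensional F-vector spaces decomposes as a finite direct sum of interval representations: V ≅ ⊕_{k} I_{[a_k, b_k]}, where for integers 1 ≤ a ≤ b ≤ n the interval representation I_{[a,b]} assigns F to each i ∈ {a, …, b} and 0 otherwise, with identity maps between consecutive indices inside [a,b] and zero maps otherwise. Moreover, the multiset of intervals [a_k, b_k] is uniquely determined by V (zigzag persistence barcode). -/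
open scoped Classical

/-- A zigzag module over the fence (zigzag) poset on `{0, …, m}` with orientation
`τ : Fin m → Bool` (`true` = right, i.e. `i ≤ i+1`; `false` = left, i.e. `i+1 ≤ i`):
a functor from the fence poset to `F`-vector spaces, recorded by its spaces and the
structure maps along the generating relations. -/
structure Zigzag (F : Type) [Field F] (m : ℕ) (τ : Fin m → Bool) where
  space : Fin (m + 1) → Type
  [instAdd : ∀ i, AddCommGroup (space i)]
  [instMod : ∀ i, Module F (space i)]
  fwd : ∀ i : Fin m, τ i = true → (space i.castSucc →ₗ[F] space i.succ)
  bwd : ∀ i : Fin m, τ i = false → (space i.succ →ₗ[F] space i.castSucc)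

attribute [instance] Zigzag.instAdd Zigzag.instMod

variable {F : Type} [Field F] {m : ℕ} {τ : Fin m → Bool}

/-- Isomorphism of zigzag modules: pointwise linear equivalences commuting with all
structure maps. -/
def Zigzag.Iso (V W : Zigzag F m τ) : Prop :=
  ∃ e : ∀ i, V.space i ≃ₗ[F] W.space i,
    (∀ (i : Fin m) (h : τ i = true),
      (e i.succ).toLinearMap ∘ₗ V.fwd i h = W.fwd i h ∘ₗ (e i.castSucc).toLinearMap) ∧
    (∀ (i : Fin m) (h : τ i = false),
      (e i.castSucc).toLinearMap ∘ₗ V.bwd i h = W.bwd i h ∘ₗ (e i.succ).toLinearMap)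

/-- The direct sum of the interval representations `I_{[a k, b k]}`, `k : K`: at each
vertex `i` it has one copy of `F` for each `k` with `a k ≤ i ≤ b k`, and all structure
maps between consecutive vertices are identities inside the intervals and zero
otherwise. -/
noncomputable def intervalSumZigzag (F : Type) [Field F] (m : ℕ) (τ : Fin m → Bool)
    {K : Type} [Fintype K] (a b : K → Fin (m + 1)) : Zigzag F m τ where
  space i := ∀ k : K, PLift (a k ≤ i ∧ i ≤ b k) → F
  fwd i _ :=
    { toFun := fun f k _ => if h : a k ≤ i.castSucc ∧ i.castSucc ≤ b k then f k ⟨h⟩ else 0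
      map_add' := by intro f g; funext k h'; dsimp; split <;> simp
      map_smul' := by intro c f; funext k h'; dsimp; split <;> simp }
  bwd i _ :=
    { toFun := fun f k _ => if h : a k ≤ i.succ ∧ i.succ ≤ b k then f k ⟨h⟩ else 0
      map_add' := by intro f g; funext k h'; dsimp; split <;> simp
      map_smul' := by intro c f; funext k h'; dsimp; split <;> simp }

namespace ZZ

/-- Arrows of the fence quiver. -/
def Arr (τ : Fin m → Bool) (p q : Fin (m + 1)) : Prop :=
  ∃ i : Fin m, (τ i = true ∧ p = i.castSucc ∧ q = i.succ) ∨
    (τ i = false ∧ p = i.succ ∧ q = i.castSucc)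

lemma arr_or (τ : Fin m → Bool) (i : Fin m) :
    Arr τ i.castSucc i.succ ∨ Arr τ i.succ i.castSucc := by
  cases h : τ i
  · exact Or.inr ⟨i, Or.inr ⟨h, rfl, rfl⟩⟩
  · exact Or.inl ⟨i, Or.inl ⟨h, rfl, rfl⟩⟩

/-- The product of matrix entries through a different interval vanishes. -/
lemma prod_zero (s t s' t' : Fin (m + 1)) (_hst' : s' ≤ t')
    (M N : Fin (m + 1) → F)
    (hM0 : ∀ i, ¬ ((s ≤ i ∧ i ≤ t) ∧ (s' ≤ i ∧ i ≤ t')) → M i = 0)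
    (hN0 : ∀ i, ¬ ((s ≤ i ∧ i ≤ t) ∧ (s' ≤ i ∧ i ≤ t')) → N i = 0)
    (hM : ∀ p q, Arr τ p q → (s ≤ p ∧ p ≤ t) → (s' ≤ q ∧ q ≤ t') → M q = M p)
    (hN : ∀ p q, Arr τ p q → (s' ≤ p ∧ p ≤ t') → (s ≤ q ∧ q ≤ t) → N q = N p)
    (hne : ¬ (s = s' ∧ t = t')) :
    ∀ i, N i * M i = 0 := by
  have harr : ∀ p q, Arr τ p q → (s ≤ p ∧ p ≤ t) → (s ≤ q ∧ q ≤ t) →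
      N q * M q = N p * M p := by
    intro p q h hp hq
    by_cases hq' : s' ≤ q ∧ q ≤ t' <;> by_cases hp' : s' ≤ p ∧ p ≤ t'
    · rw [hM p q h hp hq', hN p q h hp' hq]
    · rw [hM p q h hp hq', hM0 p (by tauto)]; simp
    · rw [← hN p q h hp' hq, hN0 q (by tauto)]; simp
    · rw [hM0 p (by tauto), hM0 q (by tauto)]; simp
  have hstep : ∀ i : Fin m, s ≤ i.castSucc → i.succ ≤ t →
      N i.succ * M i.succ = N i.castSucc * M i.castSucc := by
    intro i h1 h2
    have h3 : i.castSucc ≤ t := by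
      rw [Fin.le_def] at *; simp at *; omega
    have h4 : s ≤ i.succ := by
      rw [Fin.le_def] at *; simp at *; omega
    rcases arr_or τ i with h | h
    · exact harr _ _ h ⟨h1, h3⟩ ⟨h4, h2⟩
    · exact (harr _ _ h ⟨h4, h2⟩ ⟨h1, h3⟩).symm
  have hconst : ∀ i, s ≤ i → i ≤ t → N i * M i = N s * M s := by
    intro i
    induction i using Fin.induction with
    | zero =>
      intro h1 h2
      have : s = 0 := le_antisymm h1 (Fin.zero_le _)
      rw [this]
    | succ i ih =>
      intro h1 h2
      by_cases h : s = i.succ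
      · rw [h]
      · have h3 : s ≤ i.castSucc := by
          rw [Fin.le_def] at *; rw [Fin.ext_iff] at h; simp at *; omega
        have h4 : i.castSucc ≤ t := by
          rw [Fin.le_def] at *; simp at *; omega
        rw [hstep i h3 h2, ih h3 h4]
  have hex : (s ≤ t) → ∃ i, s ≤ i ∧ i ≤ t ∧ N i * M i = 0 := by
    intro hst
    by_cases h1 : s' ≤ s
    · by_cases h2 : t ≤ t'
      · by_cases h3 : s' = s
        · have h4 : t < t' := lt_of_le_of_ne h2 (fun h => hne ⟨h3.symm, h⟩)
          have h5 : (t : ℕ) < m := by have := t'.2; rw [Fin.lt_def] at h4; omega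
          refine ⟨t, hst, le_rfl, ?_⟩
          have e1 : t = (⟨t, h5⟩ : Fin m).castSucc := rfl
          have hout : ¬ (⟨t, h5⟩ : Fin m).succ ≤ t := by rw [Fin.le_def]; simp
          have hin : (⟨t, h5⟩ : Fin m).succ ≤ t' := by
            rw [Fin.le_def]; simpa using h4
          have hin2 : s' ≤ (⟨t, h5⟩ : Fin m).succ := by
            rw [Fin.le_def] at *; simp; omega
          rcases arr_or τ ⟨t, h5⟩ with h | h
          · rw [← e1] at h
            rw [← hM _ _ h ⟨hst, le_rfl⟩ ⟨hin2, hin⟩, hM0 _ (by tauto), mul_zero]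
          · rw [← e1] at h
            rw [hN _ _ h ⟨hin2, hin⟩ ⟨hst, le_rfl⟩, hN0 _ (by tauto), zero_mul]
        · have h4 : s' < s := lt_of_le_of_ne h1 h3
          have h6 : (s' : ℕ) < s := h4
          have h5 : (s : ℕ) - 1 < m := by have := s.2; omega
          refine ⟨s, le_rfl, hst, ?_⟩
          have e1 : s = (⟨(s : ℕ) - 1, h5⟩ : Fin m).succ := by
            rw [Fin.ext_iff]; simp; omega
          have hout : ¬ s ≤ (⟨(s : ℕ) - 1, h5⟩ : Fin m).castSucc := by
            rw [Fin.le_def]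
            show ¬ ((s : ℕ) ≤ (s : ℕ) - 1)
            omega
          have hin : s' ≤ (⟨(s : ℕ) - 1, h5⟩ : Fin m).castSucc := by
            rw [Fin.le_def]; simp; omega
          have hin2 : (⟨(s : ℕ) - 1, h5⟩ : Fin m).castSucc ≤ t' := by
            have h7 := Fin.le_def.1 h2
            have h8 := Fin.le_def.1 hst
            rw [Fin.le_def]; simp; omega
          rcases arr_or τ ⟨(s : ℕ) - 1, h5⟩ with h | h
          · rw [← e1] at h
            rw [hN _ _ h ⟨hin, hin2⟩ ⟨le_rfl, hst⟩, hN0 _ (by tauto), zero_mul]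
          · rw [← e1] at h
            rw [← hM _ _ h ⟨le_rfl, hst⟩ ⟨hin, hin2⟩, hM0 _ (by tauto), mul_zero]
      · exact ⟨t, hst, le_rfl, by rw [hM0 _ (by tauto), mul_zero]⟩
    · exact ⟨s, le_rfl, hst, by rw [hM0 _ (by tauto), mul_zero]⟩
  intro i
  by_cases hi : s ≤ i ∧ i ≤ t
  · obtain ⟨i', h1, h2, h3⟩ := hex (hi.1.trans hi.2)
    rw [hconst i hi.1 hi.2, ← hconst i' h1 h2, h3]
  · rw [hM0 _ (by tauto), mul_zero]

section
variable {K K' : Type} [Fintype K] [Fintype K'] (a b : K → Fin (m + 1))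
  (a' b' : K' → Fin (m + 1))

/-- basis vectors -/
noncomputable def bv (τ : Fin m → Bool) (k : K) (i : Fin (m + 1)) :
    (intervalSumZigzag F m τ a b).space i :=
  fun k'' _ => if k'' = k then 1 else 0

/-- matrix entries -/
noncomputable def mat
    (φ : ∀ i, (intervalSumZigzag F m τ a b).space i →ₗ[F]
      (intervalSumZigzag F m τ a' b').space i)
    (i : Fin (m + 1)) (k' : K') (k : K) : F :=
  if h : a' k' ≤ i ∧ i ≤ b' k' then φ i (bv a b τ k i) k' ⟨h⟩ else 0

lemma bv_zero (k : K) (i : Fin (m + 1)) (h : ¬ (a k ≤ i ∧ i ≤ b k)) :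
    (bv a b τ k i : (intervalSumZigzag F m τ a b).space i) = 0 := by
  funext k'' h''
  show (if k'' = k then (1 : F) else 0) = 0
  rw [if_neg]
  rintro rfl
  exact h h''.down

lemma fwd_bv (k : K) (i : Fin m) (hτ : τ i = true)
    (h : a k ≤ i.castSucc ∧ i.castSucc ≤ b k) :
    (intervalSumZigzag F m τ a b).fwd i hτ (bv a b τ k i.castSucc) = bv a b τ k i.succ := by
  funext k'' h''
  show (if h : a k'' ≤ i.castSucc ∧ i.castSucc ≤ b k'' then
    (if k'' = k then (1 : F) else 0) else 0) = if k'' = k then (1 : F) else 0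
  by_cases hk : k'' = k
  · subst hk; simp [h]
  · simp [hk]

lemma bwd_bv (k : K) (i : Fin m) (hτ : τ i = false)
    (h : a k ≤ i.succ ∧ i.succ ≤ b k) :
    (intervalSumZigzag F m τ a b).bwd i hτ (bv a b τ k i.succ) = bv a b τ k i.castSucc := by
  funext k'' h''
  show (if h : a k'' ≤ i.succ ∧ i.succ ≤ b k'' then
    (if k'' = k then (1 : F) else 0) else 0) = if k'' = k then (1 : F) else 0
  by_cases hk : k'' = k
  · subst hk; simp [h]
  · simp [hk]

lemma mat_zero
    (φ : ∀ i, (intervalSumZigzag F m τ a b).space i →ₗ[F]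
      (intervalSumZigzag F m τ a' b').space i)
    (i : Fin (m + 1)) (k' : K') (k : K)
    (h : ¬ ((a k ≤ i ∧ i ≤ b k) ∧ (a' k' ≤ i ∧ i ≤ b' k'))) : mat a b a' b' φ i k' k = 0 := by
  unfold mat
  split_ifs with h'
  · rw [bv_zero a b k i (by tauto), map_zero]; rfl
  · rfl

lemma mat_arr
    (φ : ∀ i, (intervalSumZigzag F m τ a b).space i →ₗ[F]
      (intervalSumZigzag F m τ a' b').space i)
    (hf : ∀ (i : Fin m) (h : τ i = true) x,
      φ i.succ ((intervalSumZigzag F m τ a b).fwd i h x) =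
        (intervalSumZigzag F m τ a' b').fwd i h (φ i.castSucc x))
    (hb : ∀ (i : Fin m) (h : τ i = false) x,
      φ i.castSucc ((intervalSumZigzag F m τ a b).bwd i h x) =
        (intervalSumZigzag F m τ a' b').bwd i h (φ i.succ x))
    (k' : K') (k : K) (p q : Fin (m + 1)) (hpq : Arr τ p q)
    (hp : a k ≤ p ∧ p ≤ b k) (hq : a' k' ≤ q ∧ q ≤ b' k') :
    mat a b a' b' φ q k' k = mat a b a' b' φ p k' k := by
  obtain ⟨i, ⟨hτ, rfl, rfl⟩ | ⟨hτ, rfl, rfl⟩⟩ := hpq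
  · have := congrFun (congrFun (hf i hτ (bv a b τ k i.castSucc)) k') ⟨hq⟩
    rw [fwd_bv a b k i hτ hp] at this
    unfold mat
    rw [dif_pos hq, this]
    rfl
  · have := congrFun (congrFun (hb i hτ (bv a b τ k i.succ)) k') ⟨hq⟩
    rw [bwd_bv a b k i hτ hp] at this
    unfold mat
    rw [dif_pos hq, this]
    rfl

lemma bv_expand (i : Fin (m + 1)) (x : (intervalSumZigzag F m τ a b).space i) :
    x = ∑ k, (if h : a k ≤ i ∧ i ≤ b k then x k ⟨h⟩ else 0) • bv a b τ k i := by
  funext k' h'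
  have : (∑ k, (if h : a k ≤ i ∧ i ≤ b k then x k ⟨h⟩ else 0) • bv a b τ k i :
      (intervalSumZigzag F m τ a b).space i) k' h' =
      ∑ k, (if h : a k ≤ i ∧ i ≤ b k then x k ⟨h⟩ else 0) * (if k' = k then (1 : F) else 0) := by
    erw [Finset.sum_apply, Finset.sum_apply]
    rfl
  rw [this]
  simp [h'.down]

lemma mat_mul
    (φ : ∀ i, (intervalSumZigzag F m τ a b).space i →ₗ[F]
      (intervalSumZigzag F m τ a' b').space i)
    (ψ : ∀ i, (intervalSumZigzag F m τ a' b').space i →ₗ[F]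
      (intervalSumZigzag F m τ a b).space i)
    (hψφ : ∀ i x, ψ i (φ i x) = x) (i : Fin (m + 1)) (k₁ k : K)
    (h : a k₁ ≤ i ∧ i ≤ b k₁) :
    ∑ k', mat a' b' a b ψ i k₁ k' * mat a b a' b' φ i k' k = if k₁ = k then 1 else 0 := by
  have h1 := hψφ i (bv a b τ k i)
  rw [bv_expand a' b' i (φ i (bv a b τ k i)), map_sum] at h1
  have h2 := congrFun (congrFun h1 k₁) ⟨h⟩
  have h3 : (bv a b τ k i : (intervalSumZigzag F m τ a b).space i) k₁ ⟨h⟩ =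
    if k₁ = k then (1 : F) else 0 := rfl
  rw [h3] at h2
  rw [← h2]
  erw [Finset.sum_apply, Finset.sum_apply]
  refine Finset.sum_congr rfl fun k' _ => ?_
  rw [map_smul, mul_comm]
  unfold mat
  rw [dif_pos h]
  rfl

lemma card_le_of_iso (hab' : ∀ k, a' k ≤ b' k)
    (φ : ∀ i, (intervalSumZigzag F m τ a b).space i →ₗ[F]
      (intervalSumZigzag F m τ a' b').space i)
    (ψ : ∀ i, (intervalSumZigzag F m τ a' b').space i →ₗ[F]
      (intervalSumZigzag F m τ a b).space i)
    (hψφ : ∀ i x, ψ i (φ i x) = x)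
    (hf : ∀ (i : Fin m) (h : τ i = true) x,
      φ i.succ ((intervalSumZigzag F m τ a b).fwd i h x) =
        (intervalSumZigzag F m τ a' b').fwd i h (φ i.castSucc x))
    (hb : ∀ (i : Fin m) (h : τ i = false) x,
      φ i.castSucc ((intervalSumZigzag F m τ a b).bwd i h x) =
        (intervalSumZigzag F m τ a' b').bwd i h (φ i.succ x))
    (hf' : ∀ (i : Fin m) (h : τ i = true) x,
      ψ i.succ ((intervalSumZigzag F m τ a' b').fwd i h x) =
        (intervalSumZigzag F m τ a b).fwd i h (ψ i.castSucc x))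
    (hb' : ∀ (i : Fin m) (h : τ i = false) x,
      ψ i.castSucc ((intervalSumZigzag F m τ a' b').bwd i h x) =
        (intervalSumZigzag F m τ a b).bwd i h (ψ i.succ x))
    (s t : Fin (m + 1)) (hst : s ≤ t) :
    Fintype.card {k // a k = s ∧ b k = t} ≤ Fintype.card {k // a' k = s ∧ b' k = t} := by
  let M : Matrix {k // a' k = s ∧ b' k = t} {k // a k = s ∧ b k = t} F :=
    fun k' k => mat a b a' b' φ s k' k
  let N : Matrix {k // a k = s ∧ b k = t} {k // a' k = s ∧ b' k = t} F :=
    fun k k' => mat a' b' a b ψ s k k'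
  have hNM : N * M = 1 := by
    ext ⟨k₁, hk₁⟩ ⟨k, hk⟩
    have h1 := mat_mul a b a' b' φ ψ hψφ s k₁ k (by rw [hk₁.1, hk₁.2]; exact ⟨le_rfl, hst⟩)
    have h2 : ∀ k', ¬ (a' k' = s ∧ b' k' = t) →
        mat a' b' a b ψ s k₁ k' * mat a b a' b' φ s k' k = 0 := by
      intro k' hk'
      refine prod_zero (τ := τ) s t (a' k') (b' k') (hab' k') (fun i => mat a b a' b' φ i k' k)
        (fun i => mat a' b' a b ψ i k₁ k') ?_ ?_ ?_ ?_ ?_ s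
      · intro i hi
        exact mat_zero _ _ _ _ _ _ _ _ (by rw [hk.1, hk.2]; exact hi)
      · intro i hi
        exact mat_zero _ _ _ _ _ _ _ _ (by rw [hk₁.1, hk₁.2]; tauto)
      · intro p q h hp hq
        exact mat_arr _ _ _ _ φ hf hb _ _ _ _ h (by rw [hk.1, hk.2]; exact hp) hq
      · intro p q h hp hq
        exact mat_arr _ _ _ _ ψ hf' hb' _ _ _ _ h hp (by rw [hk₁.1, hk₁.2]; exact hq)
      · tauto
    rw [Matrix.mul_apply, Matrix.one_apply]
    have h3 : ∑ j : {k // a' k = s ∧ b' k = t}, N ⟨k₁, hk₁⟩ j * M j ⟨k, hk⟩ =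
        ∑ k', mat a' b' a b ψ s k₁ k' * mat a b a' b' φ s k' k := by
      rw [← Fintype.sum_subtype_add_sum_subtype (fun k' => a' k' = s ∧ b' k' = t)
        (fun k' => mat a' b' a b ψ s k₁ k' * mat a b a' b' φ s k' k)]
      rw [Finset.sum_eq_zero (f := fun i : {x // ¬ (a' x = s ∧ b' x = t)} => _)
        (fun i _ => h2 i i.2), add_zero]
    rw [h3, h1]
    simp [Subtype.ext_iff]
  have h1 := Matrix.rank_mul_le_right N M
  rw [hNM, Matrix.rank_one] at h1
  exact h1.trans (Matrix.rank_le_card_height M)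

end

lemma unique_part (V : Zigzag F m τ) (K K' : Type) [Fintype K] [Fintype K']
    (a b : K → Fin (m + 1)) (a' b' : K' → Fin (m + 1))
    (hab : ∀ k, a k ≤ b k) (hab' : ∀ k, a' k ≤ b' k)
    (h : V.Iso (intervalSumZigzag F m τ a b)) (h' : V.Iso (intervalSumZigzag F m τ a' b')) :
    Multiset.map (fun k => (a k, b k)) Finset.univ.val
        = Multiset.map (fun k => (a' k, b' k)) Finset.univ.val := by
  obtain ⟨e, hef, heb⟩ := h
  obtain ⟨e', hef', heb'⟩ := h'
  replace hef := fun i hi x => LinearMap.congr_fun (hef i hi) x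
  replace hef' := fun i hi x => LinearMap.congr_fun (hef' i hi) x
  replace heb := fun i hi x => LinearMap.congr_fun (heb i hi) x
  replace heb' := fun i hi x => LinearMap.congr_fun (heb' i hi) x
  simp only [LinearMap.comp_apply, LinearEquiv.coe_coe] at hef hef' heb heb'
  let φ := fun i => ((e i).symm.trans (e' i)).toLinearMap
  let ψ := fun i => ((e' i).symm.trans (e i)).toLinearMap
  have hf : ∀ (i : Fin m) (h : τ i = true) x,
      φ i.succ ((intervalSumZigzag F m τ a b).fwd i h x) =
        (intervalSumZigzag F m τ a' b').fwd i h (φ i.castSucc x) := by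
    intro i h x
    have := hef i h ((e i.castSucc).symm x)
    rw [LinearEquiv.apply_symm_apply] at this
    simp [φ, ← this, hef']
  have hf' : ∀ (i : Fin m) (h : τ i = true) x,
      ψ i.succ ((intervalSumZigzag F m τ a' b').fwd i h x) =
        (intervalSumZigzag F m τ a b).fwd i h (ψ i.castSucc x) := by
    intro i h x
    have := hef' i h ((e' i.castSucc).symm x)
    rw [LinearEquiv.apply_symm_apply] at this
    simp [ψ, ← this, hef]
  have hb : ∀ (i : Fin m) (h : τ i = false) x,
      φ i.castSucc ((intervalSumZigzag F m τ a b).bwd i h x) =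
        (intervalSumZigzag F m τ a' b').bwd i h (φ i.succ x) := by
    intro i h x
    have := heb i h ((e i.succ).symm x)
    rw [LinearEquiv.apply_symm_apply] at this
    simp [φ, ← this, heb']
  have hb' : ∀ (i : Fin m) (h : τ i = false) x,
      ψ i.castSucc ((intervalSumZigzag F m τ a' b').bwd i h x) =
        (intervalSumZigzag F m τ a b).bwd i h (ψ i.succ x) := by
    intro i h x
    have := heb' i h ((e' i.succ).symm x)
    rw [LinearEquiv.apply_symm_apply] at this
    simp [ψ, ← this, heb]
  have hψφ : ∀ i x, ψ i (φ i x) = x := by intro i x; simp [φ, ψ]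
  have hφψ : ∀ i x, φ i (ψ i x) = x := by intro i x; simp [φ, ψ]
  ext ⟨s, t⟩
  rw [Multiset.count_map, Multiset.count_map]
  by_cases hst : s ≤ t
  · have h1 := card_le_of_iso a b a' b' hab' φ ψ hψφ hf hb hf' hb' s t hst
    have h2 := card_le_of_iso a' b' a b hab ψ φ hφψ hf' hb' hf hb s t hst
    have h3 := le_antisymm h1 h2
    rw [Fintype.card_subtype, Fintype.card_subtype] at h3
    simpa [Finset.card_def, Finset.filter_val, Prod.ext_iff, eq_comm] using h3
  · rw [Multiset.filter_eq_nil.2, Multiset.filter_eq_nil.2]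
    · simp; 
    · intro k _ hk
      simp only [Prod.ext_iff] at hk
      exact hst (hk.1 ▸ hk.2 ▸ hab' k)
    · intro k _ hk
      simp only [Prod.ext_iff] at hk
      exact hst (hk.1 ▸ hk.2 ▸ hab k)

end ZZ

namespace ZZ

/-- A family adapted to a collection of subspaces. -/
def Good {V K : Type} [AddCommGroup V] [Module F V] [Fintype K]
    (C : Set (Submodule F V)) (y : K → V) : Prop :=
  ∀ U ∈ C, ∀ c : K → F, ∑ k, c k • y k ∈ U → ∀ k, c k ≠ 0 → y k ∈ U

/-- A spanning family. -/
def Spans (F : Type) [Field F] {V K : Type} [AddCommGroup V] [Module F V] [Fintype K]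
    (y : K → V) : Prop :=
  ∀ v, ∃ c : K → F, ∑ k, c k • y k = v

lemma Good.equiv {V K K' : Type} [AddCommGroup V] [Module F V] [Fintype K] [Fintype K']
    {C : Set (Submodule F V)} {y : K → V} (h : Good C y) (e : K' ≃ K) (y' : K' → V)
    (hy : ∀ k, y' k = y (e k)) : Good C y' := by
  intro U hU c hc k hk
  have := h U hU (fun k => c (e.symm k)) ?_ (e k) (by simpa using hk)
  · rw [hy]; exact this
  · rw [← e.sum_comp]; simpa [hy] using hc

lemma Spans.equiv {V K K' : Type} [AddCommGroup V] [Module F V] [Fintype K] [Fintype K']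
    {y : K → V} (h : Spans F y) (e : K' ≃ K) (y' : K' → V)
    (hy : ∀ k, y' k = y (e k)) : Spans F y' := by
  intro v
  obtain ⟨c, hc⟩ := h v
  refine ⟨fun k => c (e k), ?_⟩
  rw [← hc, ← e.sum_comp]; simp [hy]

lemma extend_aux {V : Type} [AddCommGroup V] [Module F V] [FiniteDimensional F V]
    (C : Set (Submodule F V)) (hC : IsChain (· ≤ ·) C) (n : ℕ) :
    ∀ (K : Type) (_ : Fintype K) (y : K → V), Good C y →
      Module.finrank F V ≤ n + Module.finrank F (Submodule.span F (Set.range y)) →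
      ∃ (L : Type) (_ : Fintype L) (z : L → V), (∀ l, z l ≠ 0) ∧
        Good C (Sum.elim y z) ∧ Spans F (Sum.elim y z) := by
  induction n with
  | zero =>
    intro K _ y hy hn
    have htop : Submodule.span F (Set.range y) = ⊤ :=
      Submodule.eq_top_of_finrank_eq (le_antisymm (Submodule.finrank_le _) (by omega))
    refine ⟨Empty, inferInstance, Empty.elim, fun l => l.elim,
      hy.equiv (Equiv.sumEmpty K Empty) _ ?_, Spans.equiv (y := y) ?_ (Equiv.sumEmpty K Empty) _ ?_⟩
    · rintro (k | l); rfl; exact l.elim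
    · intro v
      have : v ∈ Submodule.span F (Set.range y) := by rw [htop]; trivial
      exact (Submodule.mem_span_range_iff_exists_fun F).1 this
    · rintro (k | l); rfl; exact l.elim
  | succ n ih =>
    intro K _ y hy hn
    by_cases htop : Submodule.span F (Set.range y) = ⊤
    · refine ih K _ y hy ?_
      rw [htop, finrank_top]; omega
    set W := Submodule.span F (Set.range y) with hW
    have hex : {U | U ∈ insert ⊤ C ∧ ¬ U ≤ W}.Nonempty :=
      ⟨⊤, Set.mem_insert _ _, fun h => htop (top_le_iff.1 h)⟩
    obtain ⟨U₀, ⟨hU₀, hU₀W⟩, hmin⟩ :=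
      (wellFounded_lt (α := Submodule F V)).has_min _ hex
    obtain ⟨z₀, hz₀, hz₀W⟩ := SetLike.not_le_iff_exists.1 hU₀W
    have hC' : IsChain (· ≤ ·) (insert ⊤ C) := hC.insert (fun _ _ _ => Or.inr le_top)
    have hyW : ∀ c : K → F, ∑ k, c k • y k ∈ W := fun c =>
      Submodule.sum_mem _ fun k _ => Submodule.smul_mem _ _
        (Submodule.subset_span (Set.mem_range_self k))
    have hgood : Good C (Sum.elim y (fun _ : Unit => z₀)) := by
      intro U hU c hc k hk
      rw [Fintype.sum_sum_type] at hc
      simp only [Sum.elim_inl, Sum.elim_inr, Finset.univ_unique, Finset.sum_singleton] at hc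
      by_cases hz : z₀ ∈ U
      · have h1 := (Submodule.add_mem_iff_left U (Submodule.smul_mem _ _ hz)).1 hc
        rcases k with k | u
        · exact hy U hU _ h1 k hk
        · exact hz
      · have hUW : U ≤ W := by
          by_contra hcon
          have h2 := hmin U ⟨Set.mem_insert_of_mem _ hU, hcon⟩
          rcases hC'.total (Set.mem_insert_of_mem _ hU) hU₀ with h | h
          · rcases h.lt_or_eq with h | h
            · exact h2 h
            · exact hz (h ▸ hz₀)
          · exact hz (h hz₀)
        have h3 : c (Sum.inr default) • z₀ ∈ W :=
          (Submodule.add_mem_iff_right W (hyW (fun k => c (Sum.inl k)))).1 (hUW hc)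
        have h4 : c (Sum.inr default) = 0 := by
          by_contra h
          exact hz₀W ((Submodule.smul_mem_iff W h).1 h3)
        rw [h4, zero_smul, add_zero] at hc
        rcases k with k | u
        · exact hy U hU _ hc k hk
        · exact absurd h4 hk
    obtain ⟨L, _, z, hz, hg, hs⟩ := ih (K ⊕ Unit) _ _ hgood (by
      have : W < Submodule.span F (Set.range (Sum.elim y (fun _ : Unit => z₀))) := by
        refine lt_of_le_of_ne (Submodule.span_mono ?_) ?_
        · rintro _ ⟨k, rfl⟩; exact ⟨Sum.inl k, rfl⟩
        · intro h
          apply hz₀W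
          rw [h]
          exact Submodule.subset_span ⟨Sum.inr (), rfl⟩
      have := Submodule.finrank_lt_finrank_of_lt this
      omega)
    refine ⟨Unit ⊕ L, inferInstance, Sum.elim (fun _ => z₀) z, ?_,
      hg.equiv (Equiv.sumAssoc K Unit L).symm _ ?_, hs.equiv (Equiv.sumAssoc K Unit L).symm _ ?_⟩
    · rintro (l | l)
      · rintro rfl
        exact hz₀W (Submodule.zero_mem _)
      · exact hz l
    · rintro (k | k | k) <;> rfl
    · rintro (k | k | k) <;> rfl

lemma extend {V : Type} [AddCommGroup V] [Module F V] [FiniteDimensional F V]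
    (C : Set (Submodule F V)) (hC : IsChain (· ≤ ·) C)
    (K : Type) [Fintype K] (y : K → V) (hy : Good C y) :
      ∃ (L : Type) (_ : Fintype L) (z : L → V), (∀ l, z l ≠ 0) ∧
        Good C (Sum.elim y z) ∧ Spans F (Sum.elim y z) :=
  extend_aux C hC _ K _ y hy (Nat.le_add_right _ _)

lemma exists_lift {V W : Type} [AddCommGroup V] [Module F V] [AddCommGroup W] [Module F W]
    [FiniteDimensional F W] (g : W →ₗ[F] V)
    (C : Set (Submodule F W)) (hC : IsChain (· ≤ ·) C) (x : V) :
    ∃ y : W, (x ∈ LinearMap.range g → g y = x ∧ ∀ U ∈ C, x ∈ U.map g → y ∈ U) ∧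
      (x ∉ LinearMap.range g → y = 0) := by
  by_cases hx : x ∈ LinearMap.range g
  swap
  · exact ⟨0, fun h => absurd h hx, fun _ => rfl⟩
  have hex : {U | U ∈ insert ⊤ C ∧ x ∈ Submodule.map g U}.Nonempty :=
    ⟨⊤, Set.mem_insert _ _, by rw [← LinearMap.range_eq_map]; exact hx⟩
  obtain ⟨U₀, ⟨hU₀, hxU₀⟩, hmin⟩ := (wellFounded_lt (α := Submodule F W)).has_min _ hex
  have hC' : IsChain (· ≤ ·) (insert ⊤ C) := hC.insert (fun _ _ _ => Or.inr le_top)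
  obtain ⟨y, hy, hyx⟩ := hxU₀
  refine ⟨y, fun _ => ⟨hyx, fun U hU hxU => ?_⟩, fun h => absurd hx h⟩
  have h2 := hmin U ⟨Set.mem_insert_of_mem _ hU, hxU⟩
  rcases hC'.total (Set.mem_insert_of_mem _ hU) hU₀ with h | h
  · rcases h.lt_or_eq with h | h
    · exact absurd h h2
    · exact h ▸ hy
  · exact h hy

lemma bwd_step {V W K : Type} [AddCommGroup V] [Module F V] [AddCommGroup W] [Module F W]
    [FiniteDimensional F W] [Fintype K] (g : W →ₗ[F] V)
    (C : Set (Submodule F W)) (hC : IsChain (· ≤ ·) C) (hbot : ⊥ ∈ C) (x : K → V)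
    (hx : Good (Submodule.map g '' (insert ⊤ C)) x) (hs : Spans F x) :
    ∃ (y : K → W) (L : Type) (_ : Fintype L) (z : L → W), (∀ l, z l ≠ 0) ∧
      Good C (Sum.elim y z) ∧ Spans F (Sum.elim y z) ∧ (∀ k, x k = 0 → y k = 0) ∧
      (∀ k, y k ≠ 0 → g (y k) = x k) ∧ ∀ l, g (z l) = 0 := by
  choose y hy1 hy2 using fun k => exists_lift g C hC (x k)
  have hchain : IsChain (· ≤ ·) (Submodule.comap (LinearMap.ker g).subtype '' C) := by
    rintro _ ⟨U, hU, rfl⟩ _ ⟨U', hU', rfl⟩ _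
    exact (hC.total hU hU').imp (fun h => Submodule.comap_mono h) (fun h => Submodule.comap_mono h)
  obtain ⟨L, _, z, hz, hg, hsp⟩ := extend _ hchain Empty Empty.elim
    (fun U hU c hc k => k.elim)
  refine ⟨y, L, inferInstance, fun l => (z l : W), ?_, ?_, ?_, ?_, ?_, ?_⟩
  · intro l h
    exact hz l (Subtype.ext h)
  · intro U hU c hc
    rw [Fintype.sum_sum_type] at hc
    simp only [Sum.elim_inl, Sum.elim_inr] at hc
    have h1 : ∑ k, (if x k ∈ LinearMap.range g then c (Sum.inl k) else 0) • x k ∈ U.map g := by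
      refine ⟨_, hc, ?_⟩
      rw [map_add, map_sum, map_sum]
      have : ∑ l, g (c (Sum.inr l) • (z l : W)) = 0 :=
        Finset.sum_eq_zero fun l _ => by
          rw [map_smul, LinearMap.mem_ker.1 (z l).2, smul_zero]
      rw [this, add_zero]
      refine Finset.sum_congr rfl fun k _ => ?_
      rw [map_smul]
      split_ifs with h
      · rw [(hy1 k h).1]
      · rw [hy2 k h]; simp
    have h2 : ∀ k, c (Sum.inl k) ≠ 0 → y k ∈ U := by
      intro k hk
      by_cases h : x k ∈ LinearMap.range g
      · refine (hy1 k h).2 U hU (hx _ ⟨U, Set.mem_insert_of_mem _ hU, rfl⟩ _ h1 k ?_)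
        rwa [if_pos h]
      · rw [hy2 k h]; exact U.zero_mem
    have h3 : ∑ k, c (Sum.inl k) • y k ∈ U := by
      refine Submodule.sum_mem _ fun k _ => ?_
      by_cases h : c (Sum.inl k) = 0
      · rw [h, zero_smul]; exact U.zero_mem
      · exact U.smul_mem _ (h2 k h)
    have h4 := (Submodule.add_mem_iff_right U h3).1 hc
    rintro (k | l) hk
    · exact h2 k hk
    · refine hg _ ⟨U, hU, rfl⟩ (Sum.elim Empty.elim (fun l => c (Sum.inr l))) ?_ (Sum.inr l) hk
      rw [Fintype.sum_sum_type]
      simpa using h4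
  · intro v
    obtain ⟨c, hc⟩ := hs (g v)
    have hcr : ∀ k, c k ≠ 0 → x k ∈ LinearMap.range g := by
      intro k hk
      have := hx _ ⟨⊤, Set.mem_insert _ _, rfl⟩ c (by rw [hc]; exact ⟨v, trivial, rfl⟩) k hk
      rwa [← LinearMap.range_eq_map] at this
    have hker : v - ∑ k, c k • y k ∈ LinearMap.ker g := by
      rw [LinearMap.mem_ker, map_sub, map_sum, ← hc, sub_eq_zero]
      refine Finset.sum_congr rfl fun k _ => ?_
      by_cases h : c k = 0
      · simp [h]
      · rw [map_smul, (hy1 k (hcr k h)).1]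
    obtain ⟨d, hd⟩ := hsp ⟨_, hker⟩
    refine ⟨Sum.elim c (fun l => d (Sum.inr l)), ?_⟩
    rw [Fintype.sum_sum_type] at hd ⊢
    have := congrArg Subtype.val hd
    simp only [Sum.elim_inl, Sum.elim_inr, Finset.univ_eq_empty, Finset.sum_empty, zero_add,
      Submodule.coe_sum, Submodule.coe_smul] at this ⊢
    rw [this]; abel
  · intro k hk
    have h0 : x k ∈ LinearMap.range g := by rw [hk]; exact Submodule.zero_mem _
    have := (hy1 k h0).2 ⊥ hbot (by rw [hk]; exact Submodule.zero_mem _)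
    simpa using this
  · intro k hk
    by_cases h : x k ∈ LinearMap.range g
    · exact (hy1 k h).1
    · exact absurd (hy2 k h) hk
  · intro l
    exact LinearMap.mem_ker.1 (z l).2

lemma fwd_step {V W K : Type} [AddCommGroup V] [Module F V] [AddCommGroup W] [Module F W]
    [FiniteDimensional F W] [Fintype K] (f : V →ₗ[F] W)
    (C : Set (Submodule F W)) (hC : IsChain (· ≤ ·) C) (x : K → V)
    (hx : Good (Submodule.comap f '' C) x) :
    ∃ (L : Type) (_ : Fintype L) (z : L → W), (∀ l, z l ≠ 0) ∧
      Good C (Sum.elim (fun k => f (x k)) z) ∧ Spans F (Sum.elim (fun k => f (x k)) z) := by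
  refine extend C hC K _ ?_
  intro U hU c hc k hk
  refine hx _ ⟨U, hU, rfl⟩ c ?_ k hk
  simpa [map_sum] using hc

/-- Partial interval basis on the vertices up to `j`, adapted to `C` at `j`. -/
structure PB (V : Zigzag F m τ) (j : Fin (m + 1)) (C : Set (Submodule F (V.space j)))
    (K : Type) [Fintype K] (a b : K → Fin (m + 1)) (x : K → ∀ i, V.space i) : Prop where
  ab : ∀ k, a k ≤ b k
  bj : ∀ k, b k ≤ j
  supp : ∀ k i, x k i ≠ 0 ↔ a k ≤ i ∧ i ≤ b k
  li : ∀ i ≤ j, Good (F := F) {⊥} (fun k => x k i)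
  sp : ∀ i ≤ j, Spans F (fun k => x k i)
  fw : ∀ i : Fin m, i.succ ≤ j → ∀ h : τ i = true, ∀ k, x k i.castSucc ≠ 0 →
    V.fwd i h (x k i.castSucc) = x k i.succ
  bw : ∀ i : Fin m, i.succ ≤ j → ∀ h : τ i = false, ∀ k, x k i.succ ≠ 0 →
    V.bwd i h (x k i.succ) = x k i.castSucc
  ad : Good C (fun k => x k j)

lemma pb_step (V : Zigzag F m τ) (j : Fin m) (C₀ : Set (Submodule F (V.space j.castSucc)))
    (C : Set (Submodule F (V.space j.succ))) (hbot : ⊥ ∈ C)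
    (K : Type) [Fintype K] (a b : K → Fin (m + 1)) (x : K → ∀ i, V.space i)
    (h : PB V j.castSucc C₀ K a b x) (y : K → V.space j.succ) (L : Type) [Fintype L]
    (z : L → V.space j.succ) (hz : ∀ l, z l ≠ 0) (hg : Good C (Sum.elim y z))
    (hs : Spans F (Sum.elim y z)) (hxy : ∀ k, x k j.castSucc = 0 → y k = 0)
    (hfw : ∀ (h : τ j = true) k, V.fwd j h (x k j.castSucc) = y k)
    (hbw : ∀ (h : τ j = false) k, y k ≠ 0 → V.bwd j h (y k) = x k j.castSucc)
    (hbw' : ∀ (h : τ j = false) l, V.bwd j h (z l) = 0) :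
    PB V j.succ C (K ⊕ L) (Sum.elim a (fun _ => j.succ))
      (Sum.elim (fun k => if y k ≠ 0 then j.succ else b k) (fun _ => j.succ))
      (Sum.elim (fun k => Function.update (x k) j.succ (y k))
        (fun l => Pi.single j.succ (z l))) := by
  have hlt : j.castSucc < j.succ := Fin.castSucc_lt_succ
  have hne : ∀ i, i ≤ j.castSucc → i ≠ j.succ := fun i hi => (hi.trans_lt hlt).ne
  have hle : ∀ i, i < j.succ → i ≤ j.castSucc := fun i hi => Fin.le_castSucc_iff.2 hi
  have hbk : ∀ k, y k ≠ 0 → b k = j.castSucc := by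
    intro k hk
    have : x k j.castSucc ≠ 0 := fun h0 => hk (hxy k h0)
    exact le_antisymm (h.bj k) ((h.supp k _).1 this).2
  have hat : (fun k => (Sum.elim (fun k => Function.update (x k) j.succ (y k))
        (fun l => Pi.single j.succ (z l)) : K ⊕ L → ∀ i, V.space i) k j.succ) =
        Sum.elim y z := by
    funext k
    rcases k with k | l <;> simp
  have hbelow : ∀ i, i ≠ j.succ → (fun k => (Sum.elim (fun k => Function.update (x k) j.succ (y k))
        (fun l => Pi.single j.succ (z l)) : K ⊕ L → ∀ i, V.space i) k i) =
        Sum.elim (fun k => x k i) (fun _ => 0) := by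
    intro i hi
    funext k
    rcases k with k | l <;> simp [hi]
  have hcase : ∀ i, i ≤ j.succ → i = j.succ ∨ i ≤ j.castSucc := fun i hi =>
    (hi.lt_or_eq).symm.imp id (hle i)
  refine ⟨?_, ?_, ?_, ?_, ?_, ?_, ?_, ?_⟩
  · rintro (k | l)
    · simp only [Sum.elim_inl]
      split_ifs
      · exact (h.ab k).trans ((h.bj k).trans hlt.le)
      · exact h.ab k
    · exact le_rfl
  · rintro (k | l)
    · simp only [Sum.elim_inl]
      split_ifs
      · exact le_rfl
      · exact (h.bj k).trans hlt.le
    · exact le_rfl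
  · rintro (k | l) i
    · simp only [Sum.elim_inl]
      by_cases hi : i = j.succ
      · subst hi
        rw [Function.update_self]
        split_ifs with hy
        · exact ⟨fun _ => ⟨(h.ab k).trans ((h.bj k).trans hlt.le), le_rfl⟩, fun _ => hy⟩
        · exact ⟨fun h => absurd h hy, fun h' => absurd (h'.2.trans (h.bj k)) (not_le.2 hlt)⟩
      · rw [Function.update_of_ne hi, h.supp]
        split_ifs with hy
        · rw [hbk k hy]
          refine and_congr_right fun _ => ⟨fun h => h.trans hlt.le, fun h => ?_⟩
          exact hle i (lt_of_le_of_ne h hi)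
        · rfl
    · simp only [Sum.elim_inr]
      by_cases hi : i = j.succ
      · subst hi
        simp [hz]
      · rw [Pi.single_eq_of_ne hi]
        simp only [ne_eq, not_true_eq_false, false_iff]
        exact fun h => hi (le_antisymm h.2 h.1)
  · intro i hi
    rcases hcase i hi with rfl | hi
    · rw [hat]
      intro U hU
      rw [Set.mem_singleton_iff.1 hU]
      exact hg ⊥ hbot
    · rw [hbelow i (hne i hi)]
      intro U hU c hc k hk
      rcases k with k | l
      · refine h.li i hi U hU (fun k => c (Sum.inl k)) ?_ k hk
        rw [Fintype.sum_sum_type] at hc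
        simpa using hc
      · exact U.zero_mem
  · intro i hi
    rcases hcase i hi with rfl | hi
    · rw [hat]; exact hs
    · rw [hbelow i (hne i hi)]
      intro v
      obtain ⟨c, hc⟩ := h.sp i hi v
      refine ⟨Sum.elim c 0, ?_⟩
      rw [Fintype.sum_sum_type]
      simpa using hc
  · intro i hi hτ k hk
    rcases hcase _ hi with he | hi'
    · have hij : i = j := Fin.succ_injective _ he
      subst hij
      rcases k with k | l
      · simp [hfw, hlt.ne]
      · exact absurd (by simp [hlt.ne]) hk
    · have h1 := hne _ hi'
      have h2 : i.castSucc ≠ j.succ := hne _ (Fin.castSucc_lt_succ.le.trans hi')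
      rcases k with k | l
      · simp only [Sum.elim_inl, Function.update_of_ne h1, Function.update_of_ne h2] at hk ⊢
        exact h.fw i hi' hτ k hk
      · exact absurd (by simp [h2]) hk
  · intro i hi hτ k hk
    rcases hcase _ hi with he | hi'
    · have hij : i = j := Fin.succ_injective _ he
      subst hij
      rcases k with k | l
      · simp only [Sum.elim_inl, Function.update_self, Function.update_of_ne hlt.ne] at hk ⊢
        exact hbw hτ k hk
      · simp [hbw', hlt.ne]
    · have h1 := hne _ hi'
      have h2 : i.castSucc ≠ j.succ := hne _ (Fin.castSucc_lt_succ.le.trans hi')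
      rcases k with k | l
      · simp only [Sum.elim_inl, Function.update_of_ne h1, Function.update_of_ne h2] at hk ⊢
        exact h.bw i hi' hτ k hk
      · exact absurd (by simp [h1]) hk
  · rw [hat]; exact hg

lemma pb_exists (V : Zigzag F m τ) (hfd : ∀ i, FiniteDimensional F (V.space i))
    (j : Fin (m + 1)) : ∀ C : Set (Submodule F (V.space j)), IsChain (· ≤ ·) C → ⊥ ∈ C →
      ∃ (K : Type) (_ : Fintype K) (a b : K → Fin (m + 1)) (x : K → ∀ i, V.space i),
        PB V j C K a b x := by
  induction j using Fin.induction with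
  | zero =>
    intro C hC hbot
    obtain ⟨L, _, z, hz, hg, hs⟩ := extend C hC Empty Empty.elim
      (fun U hU c hc k => k.elim)
    have hg' : Good C z := hg.equiv (Equiv.emptySum Empty L).symm _ (fun _ => rfl)
    have hs' : Spans F z := hs.equiv (Equiv.emptySum Empty L).symm _ (fun _ => rfl)
    refine ⟨L, inferInstance, fun _ => 0, fun _ => 0, fun l => Pi.single 0 (z l),
      fun _ => le_rfl, fun _ => le_rfl, ?_, ?_, ?_, ?_, ?_, ?_⟩
    · intro k i
      by_cases hi : i = 0
      · subst hi; simp [hz]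
      · rw [Pi.single_eq_of_ne hi]; simp [hi]
    · intro i hi
      obtain rfl := le_antisymm hi (Fin.zero_le _)
      simp only [Pi.single_eq_same]
      intro U hU
      rw [Set.mem_singleton_iff.1 hU]
      exact hg' ⊥ hbot
    · intro i hi
      obtain rfl := le_antisymm hi (Fin.zero_le _)
      simpa only [Pi.single_eq_same] using hs'
    · intro i hi; exact absurd hi (by simp)
    · intro i hi; exact absurd hi (by simp)
    · simpa only [Pi.single_eq_same] using hg'
  | succ j ih =>
    intro C hC hbot
    cases hτ : τ j
    · obtain ⟨K, _, a, b, x, hx⟩ := ih (Submodule.map (V.bwd j hτ) '' (insert ⊤ C)) (by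
        have hC' : IsChain (· ≤ ·) (insert ⊤ C) := hC.insert (fun _ _ _ => Or.inr le_top)
        rintro _ ⟨U, hU, rfl⟩ _ ⟨U', hU', rfl⟩ _
        exact (hC'.total hU hU').imp (fun h => Submodule.map_mono h)
          (fun h => Submodule.map_mono h))
        ⟨⊥, Set.mem_insert_of_mem _ hbot, Submodule.map_bot _⟩
      obtain ⟨y, L, _, z, h1, h2, h3, h4, h5, h6⟩ :=
        bwd_step (V.bwd j hτ) C hC hbot _ hx.ad (hx.sp _ le_rfl)
      exact ⟨_, _, _, _, _, pb_step V j _ C hbot K a b x hx y L z h1 h2 h3 h4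
        (fun h => by simp [hτ] at h) (fun _ => h5) (fun _ => h6)⟩
    · obtain ⟨K, _, a, b, x, hx⟩ := ih (insert ⊥ (Submodule.comap (V.fwd j hτ) '' C)) (by
        refine IsChain.insert ?_ (fun _ _ _ => Or.inl bot_le)
        rintro _ ⟨U, hU, rfl⟩ _ ⟨U', hU', rfl⟩ _
        exact (hC.total hU hU').imp (fun h => Submodule.comap_mono h)
          (fun h => Submodule.comap_mono h))
        (Set.mem_insert _ _)
      obtain ⟨L, _, z, h1, h2, h3⟩ :=
        fwd_step (V.fwd j hτ) C hC (fun k => x k j.castSucc)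
          (fun U hU => hx.ad U (Set.mem_insert_of_mem _ hU))
      exact ⟨_, _, _, _, _, pb_step V j _ C hbot K a b x hx _ L z h1 h2 h3
        (fun k hk => by simp [hk])
        (fun _ _ => rfl) (fun h => by simp [hτ] at h) (fun h => by simp [hτ] at h)⟩

section
variable (V : Zigzag F m τ) {K : Type} [Fintype K] (a b : K → Fin (m + 1))
  (x : K → ∀ i, V.space i)

/-- The comparison map. -/
noncomputable def cmp (i : Fin (m + 1)) :
    (intervalSumZigzag F m τ a b).space i →ₗ[F] V.space i where
  toFun f := ∑ k, (if h : a k ≤ i ∧ i ≤ b k then f k ⟨h⟩ else 0) • x k i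
  map_add' f g := by
    rw [← Finset.sum_add_distrib]
    refine Finset.sum_congr rfl fun k _ => ?_
    rw [← add_smul]
    congr 1
    split_ifs
    · rfl
    · simp
  map_smul' c f := by
    rw [RingHom.id_apply, Finset.smul_sum]
    refine Finset.sum_congr rfl fun k _ => ?_
    rw [smul_smul]
    congr 1
    split_ifs
    · rfl
    · simp

lemma cmp_apply (i : Fin (m + 1)) (f : (intervalSumZigzag F m τ a b).space i) :
    cmp V a b x i f = ∑ k, (if h : a k ≤ i ∧ i ≤ b k then f k ⟨h⟩ else 0) • x k i := rfl


lemma cmp_bij (C : Set (Submodule F (V.space (Fin.last m))))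
    (h : PB V (Fin.last m) C K a b x) (i : Fin (m + 1)) : Function.Bijective (cmp V a b x i) := by
  constructor
  · rw [← LinearMap.ker_eq_bot, LinearMap.ker_eq_bot']
    intro f hf
    funext k hk
    by_contra hne
    have := h.li i (Fin.le_last i) ⊥ rfl
      (fun k => if h : a k ≤ i ∧ i ≤ b k then f k ⟨h⟩ else 0) (by rw [Submodule.mem_bot]; exact hf) k
      (by rw [dif_pos hk.down]; exact hne)
    exact (h.supp k i).2 hk.down this
  · intro v
    obtain ⟨c, hc⟩ := h.sp i (Fin.le_last i) v
    refine ⟨fun k _ => c k, (cmp_apply V a b x i _).trans ?_⟩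
    rw [← hc]
    refine Finset.sum_congr rfl fun k _ => ?_
    split_ifs with hk
    · rfl
    · have : x k i = 0 := by
        by_contra h0
        exact hk ((h.supp k i).1 h0)
      simp [this]

lemma cmp_fwd (C : Set (Submodule F (V.space (Fin.last m))))
    (h : PB V (Fin.last m) C K a b x) (i : Fin m) (hτ : τ i = true) (f) :
    cmp V a b x i.succ ((intervalSumZigzag F m τ a b).fwd i hτ f) =
      V.fwd i hτ (cmp V a b x i.castSucc f) := by
  rw [cmp_apply, cmp_apply, map_sum]
  refine Finset.sum_congr rfl fun k _ => ?_
  rw [map_smul]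
  by_cases h1 : a k ≤ i.castSucc ∧ i.castSucc ≤ b k
  · rw [h.fw i (Fin.le_last _) hτ k ((h.supp k _).2 h1)]
    by_cases h2 : a k ≤ i.succ ∧ i.succ ≤ b k
    · rw [dif_pos h2, dif_pos h1]
      congr 1
      exact dif_pos h1
    · have : x k i.succ = 0 := by
        by_contra h0
        exact h2 ((h.supp k _).1 h0)
      simp [this]
  · rw [dif_neg h1, zero_smul]
    split_ifs with h2
    · have : (intervalSumZigzag F m τ a b).fwd i hτ f k ⟨h2⟩ = 0 := dif_neg h1
      rw [this, zero_smul]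
    · rw [zero_smul]

lemma cmp_bwd (C : Set (Submodule F (V.space (Fin.last m))))
    (h : PB V (Fin.last m) C K a b x) (i : Fin m) (hτ : τ i = false) (f) :
    cmp V a b x i.castSucc ((intervalSumZigzag F m τ a b).bwd i hτ f) =
      V.bwd i hτ (cmp V a b x i.succ f) := by
  rw [cmp_apply, cmp_apply, map_sum]
  refine Finset.sum_congr rfl fun k _ => ?_
  rw [map_smul]
  by_cases h1 : a k ≤ i.succ ∧ i.succ ≤ b k
  · rw [h.bw i (Fin.le_last _) hτ k ((h.supp k _).2 h1)]
    by_cases h2 : a k ≤ i.castSucc ∧ i.castSucc ≤ b k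
    · rw [dif_pos h2, dif_pos h1]
      congr 1
      exact dif_pos h1
    · have : x k i.castSucc = 0 := by
        by_contra h0
        exact h2 ((h.supp k _).1 h0)
      simp [this]
  · rw [dif_neg h1, zero_smul]
    split_ifs with h2
    · have : (intervalSumZigzag F m τ a b).bwd i hτ f k ⟨h2⟩ = 0 := dif_neg h1
      rw [this, zero_smul]
    · rw [zero_smul]

lemma iso_of_pb (C : Set (Submodule F (V.space (Fin.last m))))
    (h : PB V (Fin.last m) C K a b x) : V.Iso (intervalSumZigzag F m τ a b) := by
  refine ⟨fun i => (LinearEquiv.ofBijective _ (cmp_bij V a b x C h i)).symm, ?_, ?_⟩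
  · intro i hτ
    ext v
    simp only [LinearMap.comp_apply, LinearEquiv.coe_coe]
    rw [LinearEquiv.symm_apply_eq, LinearEquiv.ofBijective_apply, cmp_fwd V a b x C h]
    congr 1
    exact ((LinearEquiv.ofBijective _ (cmp_bij V a b x C h i.castSucc)).apply_symm_apply v).symm
  · intro i hτ
    ext v
    simp only [LinearMap.comp_apply, LinearEquiv.coe_coe]
    rw [LinearEquiv.symm_apply_eq, LinearEquiv.ofBijective_apply, cmp_bwd V a b x C h]
    congr 1
    exact ((LinearEquiv.ofBijective _ (cmp_bij V a b x C h i.succ)).apply_symm_apply v).symm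

end

lemma exists_part (V : Zigzag F m τ) (hfd : ∀ i, FiniteDimensional F (V.space i)) :
    ∃ (K : Type) (_ : Fintype K) (a b : K → Fin (m + 1)),
        (∀ k, a k ≤ b k) ∧ V.Iso (intervalSumZigzag F m τ a b) := by
  obtain ⟨K, _, a, b, x, h⟩ := pb_exists V hfd (Fin.last m) {⊥}
    Set.subsingleton_singleton.isChain rfl
  exact ⟨K, _, a, b, h.ab, iso_of_pb V a b x _ h⟩

end ZZ

/-- **Decomposition and barcode for zigzag persistence** (Gabriel; Carlsson–de Silva):
every pointwise finite-dimensional zigzag module of type `τ` on the fence poset with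
`m + 1 ≥ 1` vertices is isomorphic to a finite direct sum of interval representations
`I_{[a k, b k]}`, and the multiset of intervals `[a k, b k]` is uniquely determined. -/
theorem zigzag_interval_decomposition_exists_unique
    (V : Zigzag F m τ) (hfd : ∀ i, FiniteDimensional F (V.space i)) :
    (∃ (K : Type) (_ : Fintype K) (a b : K → Fin (m + 1)),
        (∀ k, a k ≤ b k) ∧ V.Iso (intervalSumZigzag F m τ a b)) ∧
    (∀ (K K' : Type) (_ : Fintype K) (_ : Fintype K')
        (a b : K → Fin (m + 1)) (a' b' : K' → Fin (m + 1)),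
      (∀ k, a k ≤ b k) → (∀ k, a' k ≤ b' k) →
      V.Iso (intervalSumZigzag F m τ a b) → V.Iso (intervalSumZigzag F m τ a' b') →
      Multiset.map (fun k => (a k, b k)) Finset.univ.val
        = Multiset.map (fun k => (a' k, b' k)) Finset.univ.val) := by
  exact ⟨ZZ.exists_part V hfd, fun K K' _ _ a b a' b' h1 h2 h3 h4 =>
    ZZ.unique_part V K K' a b a' b' h1 h2 h3 h4⟩
end
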